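/- arXiv:2409.12316 — 5 statements merged into one kernel-verified Lean document; each statement's English description precedes it below -/
import Mathlib

section
/- Let N = 3 and d ≥ 2, let K be an algebraically closed field, and let the skew-symmetric matrix α be irreducible. Then the Main Conjecture holds for α over K: for every (z₁, v) ∈ Q₁ ∩ A₂ with z₁ and v linearly independent over K, the set Q(z₁,v) = {z₂ ∈ K^d : q₂ = 0} has Krull dimension d − 1. -/
open MvPolynomial

/-- The quadratic polynomial `q_j` (for paper index `j+2`, `j : Fin (N-2)`) in the variables
`(z₂, …, z_{N-1})`, indexed by `Fin (N-2) × Fin d`, associated to the skew-symmetric matrix `α`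
and the fixed pair `(z₁, v)`. -/
noncomputable def qPoly {K : Type*} [CommRing K] (N d : ℕ) (α : Matrix (Fin N) (Fin N) K)
    (z1 v : Fin d → K) (j : Fin (N - 2)) : MvPolynomial (Fin (N - 2) × Fin d) K :=
  ∑ k : Fin d,
    X (j, k) *
      (C (α ⟨j.1 + 1, by have := j.2; omega⟩ ⟨0, by have := j.2; omega⟩ * z1 k +
            α ⟨j.1 + 1, by have := j.2; omega⟩ ⟨N - 1, by have := j.2; omega⟩ * v k) +
        ∑ i : Fin (N - 2),
          C (α ⟨j.1 + 1, by have := j.2; omega⟩ ⟨i.1 + 1, by have := i.2; omega⟩ -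
                α ⟨j.1 + 1, by have := j.2; omega⟩ ⟨N - 1, by have := j.2; omega⟩ *
                  α ⟨0, by have := j.2; omega⟩ ⟨i.1 + 1, by have := i.2; omega⟩) *
            X (i, k))

/-- An `N × N` matrix is irreducible: there is no partition of the index set into two
nonempty sets `I`, `J` with `α i j = 0` for all `i ∈ I`, `j ∈ J`. -/
def MatIrreducible {K : Type*} [CommRing K] {N : ℕ} (α : Matrix (Fin N) (Fin N) K) : Prop :=
  ∀ I : Set (Fin N), I.Nonempty → Iᶜ.Nonempty → ∃ i ∈ I, ∃ j ∈ Iᶜ, α i j ≠ 0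

/-- The (Krull) dimension of an affine algebraic set `X ⊆ K^σ`, defined as the Krull
dimension of its coordinate ring `K[X] = K[σ]/I(X)`. -/
noncomputable def algSetDim (K : Type*) [Field K] {σ : Type*} (X : Set (σ → K)) :
    WithBot ℕ∞ :=
  ringKrullDim (MvPolynomial σ K ⧸ MvPolynomial.vanishingIdeal K X)

theorem aux_height {K : Type*} [Field K] {σ : Type*} (x y : σ → K) :
    (vanishingIdeal K {x}).height = (vanishingIdeal K {y}).height := by
  have key : ∀ (t : σ → K), (aeval (fun i => X i + C (t i)) : MvPolynomial σ K →ₐ[K] _).comp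
      (aeval (fun i => X i + C (-t i)) : MvPolynomial σ K →ₐ[K] MvPolynomial σ K)
        = AlgHom.id K _ := by
    intro t
    ext i
    simp [algebraMap_eq]
  let t : σ → K := fun i => x i - y i
  let e : MvPolynomial σ K ≃ₐ[K] MvPolynomial σ K :=
    AlgEquiv.ofAlgHom (aeval (fun i => X i + C (t i))) (aeval (fun i => X i + C (-t i)))
      (key t) (by have := key (-t); simpa using this)
  have h := e.toRingEquiv.height_comap (vanishingIdeal K {y})
  rw [← h]
  congr 1
  ext p
  rw [Ideal.mem_comap, mem_vanishingIdeal_singleton_iff, mem_vanishingIdeal_singleton_iff]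
  have : ((aeval y).comp (e : MvPolynomial σ K →ₐ[K] MvPolynomial σ K)) = aeval x := by
    ext i
    simp [e, t]
  have h2 := DFunLike.congr_fun this p
  simp only [AlgHom.comp_apply] at h2
  rw [← h2]
  rfl

theorem aux_dim {K : Type*} [Field K] [IsAlgClosed K] {σ : Type*} [Finite σ]
    (q : MvPolynomial σ K) (hq : q ≠ 0) (x : σ → K) (hx : eval x q = 0) :
    algSetDim K {w : σ → K | eval w q = 0} + 1 = (Nat.card σ : WithBot ℕ∞) := by
  have hdim : ringKrullDim (MvPolynomial σ K) = (Nat.card σ : WithBot ℕ∞) := by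
    rw [MvPolynomial.ringKrullDim_of_isNoetherianRing, ringKrullDim_eq_zero_of_field, zero_add]
  have hset : {w : σ → K | eval w q = 0} = zeroLocus K (Ideal.span {q}) := by
    rw [zeroLocus_span]
    ext w
    simp [aeval_eq_eval]
  have hfin : FiniteRingKrullDim (MvPolynomial σ K) := by
    rw [finiteRingKrullDim_iff_ne_bot_and_top, hdim]
    exact ⟨by simp, fun h => ENat.natCast_ne_top (Nat.card σ) (WithBot.coe_injective h)⟩
  obtain ⟨M, hM, hMh⟩ := Ideal.exists_isMaximal_height (R := MvPolynomial σ K)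
  obtain ⟨y, rfl⟩ := isMaximal_iff_eq_vanishingIdeal_singleton.1 hM
  have hmax : (vanishingIdeal K {x}).IsMaximal :=
    isMaximal_iff_eq_vanishingIdeal_singleton.2 ⟨x, rfl⟩
  rw [aux_height y x] at hMh
  have := Module.ringKrullDim_quotient_add_one_of_mem_nonZeroDivisors
    (mem_nonZeroDivisors_of_ne_zero hq) (p := vanishingIdeal K {x}) hMh
    (by rw [mem_vanishingIdeal_singleton_iff, aeval_eq_eval]; exact hx)
  rw [← hdim, ← this, algSetDim, hset, vanishingIdeal_zeroLocus_eq_radical,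
    ringKrullDim_quotient, ringKrullDim_quotient, PrimeSpectrum.zeroLocus_radical]

/-- the Main Conjecture in the case `N = 3`: for an irreducible skew-symmetric
`3 × 3` matrix `α` over an algebraically closed field and `(z₁,v) ∈ Q₁ ∩ A₂` with `z₁, v`
linearly independent, the set `Q(z₁,v) = {z₂ ∈ K^d : q₂ = 0}` has Krull dimension `d - 1`. -/
theorem stmt3 {K : Type*} [Field K] [IsAlgClosed K] {d : ℕ} (hd : 2 ≤ d)
    (α : Matrix (Fin 3) (Fin 3) K)
    (hskew : ∀ i j, α j i = -α i j)
    (hent : ∀ i j, α i j = -1 ∨ α i j = 0 ∨ α i j = 1)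
    (hrow : ∀ i, ∃ j, α i j ≠ 0)
    (h1N : α 0 2 = 1)
    (hirr : MatIrreducible α)
    (z1 v : Fin d → K)
    (hQ1 : ∑ k : Fin d, z1 k * v k = 0)
    (hz1 : z1 ≠ 0) (hv : v ≠ 0)
    (hli : LinearIndependent K ![z1, v]) :
    algSetDim K {w : Fin (3 - 2) × Fin d → K |
        ∀ j, MvPolynomial.eval w (qPoly 3 d α z1 v j) = 0} =
      ((d - 1 : ℕ) : WithBot ℕ∞) := by
  have hc : ∃ k, α 1 0 * z1 k + α 1 2 * v k ≠ 0 := by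
    by_contra! hcon
    have h := LinearIndependent.pair_iff.1 hli (α 1 0) (α 1 2)
      (by ext k; simpa using hcon k)
    obtain ⟨i, hi, j, hj, hij⟩ := hirr {1} ⟨1, rfl⟩ ⟨0, by simp⟩
    rw [Set.mem_singleton_iff] at hi
    subst hi
    fin_cases j
    · exact hij h.1
    · exact hj rfl
    · exact hij h.2
  obtain ⟨k, hk⟩ := hc
  have hq0 : qPoly 3 d α z1 v 0 ≠ 0 := by
    intro h0
    apply hk
    have := congrArg (fun p => eval 0 (pderiv ((0 : Fin (3 - 2)), k) p)) h0
    simpa [qPoly, pderiv_X, Pi.single_apply, Prod.ext_iff, Finset.sum_ite_eq, apply_ite constantCoeff,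
      Finset.sum_add_distrib, -mul_eq_zero] using this
  have h := aux_dim (qPoly 3 d α z1 v 0) hq0 0 (by simp [qPoly])
  have hset : {w : Fin (3 - 2) × Fin d → K | ∀ j, eval w (qPoly 3 d α z1 v j) = 0} =
      {w | eval w (qPoly 3 d α z1 v 0) = 0} := by
    ext w
    constructor
    · intro hw
      exact hw 0
    · intro hw j
      have hj : j = 0 := Fin.ext (by have := j.2; simp)
      rw [hj]
      exact hw
  rw [hset]
  have hcard : Nat.card (Fin (3 - 2) × Fin d) = (d - 1) + 1 := by
    simp
    omega
  rw [hcard] at h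
  generalize algSetDim K {w : Fin (3 - 2) × Fin d → K | eval w (qPoly 3 d α z1 v 0) = 0} = D at h ⊢
  push_cast at h
  induction D with
  | bot => simp at h; cases h
  | coe D =>
    have h' : D + 1 = ((d - 1 : ℕ) : ℕ∞) + 1 := WithBot.coe_injective h
    have h2 : D = ((d - 1 : ℕ) : ℕ∞) := ENat.add_left_injective_of_ne_top (n := 1) (by simp) h'
    rw [h2]
    rfl
end

section
/- Let N = 4 and d ≥ 2, let K be an algebraically closed field, and let the skew-symmetric matrix α be irreducible. Then the Main Conjecture holds for α over K: for every (z₁, v) ∈ Q₁ ∩ A₂ with z₁ and v linearly independent over K, the set Q(z₁,v) = {(z₂,z₃) ∈ K^{2d} : q₂ = q₃ = 0} has Krull dimension 2(d − 1), i.e. it has codimension two in K^{2d}. -/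
open MvPolynomial

theorem lin_repr {K σ : Type*} [Field K] [Fintype σ] [DecidableEq σ] (s : MvPolynomial σ K)
    (hs : s.totalDegree ≤ 1) :
    s = C (coeff 0 s) + ∑ u, C (coeff (Finsupp.single u 1) s) * X u := by
  ext m
  simp only [coeff_add, coeff_C, coeff_sum, coeff_C_mul, coeff_X]
  rcases Nat.lt_or_ge 1 m.degree with h | h
  · rw [coeff_eq_zero_of_totalDegree_lt (by
      have : (∑ i ∈ m.support, m i) = m.degree := rfl
      omega)]
    rw [if_neg (by rintro rfl; simp at h)]
    rw [Finset.sum_eq_zero]; · simp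
    intro u _
    rw [if_neg (by rintro rfl; simp at h)]; simp
  · rcases Nat.lt_or_ge 0 m.degree with h0 | h0
    · have h1 : m.degree = 1 := by omega
      obtain ⟨u, rfl⟩ := (Finsupp.sum_eq_one_iff m).1 h1
      rw [if_neg (by intro h; simpa using h.symm)]
      rw [Finset.sum_eq_single u]
      · simp
      · intro b _ hb
        rw [if_neg (by intro h; exact hb (Finsupp.single_left_injective one_ne_zero h))]; simp
      · simp
    · have : m = 0 := (Finsupp.degree_eq_zero_iff m).1 (by omega)
      subst this
      simp

noncomputable def qf {K ι : Type*} [Field K] {d : ℕ} (i j : ι) (p : Fin d → K) (A B : K) :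
    MvPolynomial (ι × Fin d) K :=
  ∑ k, X (i, k) * (C (p k) + C A * X (i, k) + C B * X (j, k))

theorem qf_deg {K ι : Type*} [Field K] {d : ℕ} (i j : ι) (p : Fin d → K) (A B : K) :
    (qf i j p A B).totalDegree ≤ 2 := by
  refine totalDegree_finsetSum_le fun k _ => ?_
  refine (totalDegree_mul _ _).trans ?_
  rw [totalDegree_X]
  have : (C (p k) + C A * X (i, k) + C B * X (j, k) : MvPolynomial (ι × Fin d) K).totalDegree
      ≤ 1 := by
    have h : ∀ (A : K) u, (C A * X u : MvPolynomial (ι × Fin d) K).totalDegree ≤ 1 := fun A u =>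
      (totalDegree_mul _ _).trans (by simp)
    refine (totalDegree_add _ _).trans (max_le ((totalDegree_add _ _).trans (max_le ?_ (h _ _)))
      (h _ _))
    simp
  omega

/-- kill the variables of block `i` -/
noncomputable def kil {K ι : Type*} [Field K] [DecidableEq ι] {d : ℕ} (i : ι) :
    MvPolynomial (ι × Fin d) K →ₐ[K] MvPolynomial (ι × Fin d) K :=
  aeval fun u => if u.1 = i then 0 else X u

theorem kil_qf_self {K ι : Type*} [Field K] [DecidableEq ι] {d : ℕ} (i j : ι) (p : Fin d → K)
    (A B : K) : kil i (qf i j p A B) = 0 := by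
  simp [kil, qf]

theorem kil_qf {K ι : Type*} [Field K] [DecidableEq ι] {d : ℕ} {i j : ι} (hij : i ≠ j)
    (p : Fin d → K) (hp : p ≠ 0)
    (A B : K) : kil j (qf i j p A B) ≠ 0 := by
  obtain ⟨k, hk⟩ := Function.ne_iff.1 hp
  intro h
  have h2 := congrArg (aeval (R := K) (fun u => if u = (i,k) then (Polynomial.X : Polynomial K)
    else 0)) h
  simp [kil, qf, hij] at h2
  have h3 := congrArg (fun f => Polynomial.coeff f 0) h2
  exact hk (by simpa using h3)

theorem key {K ι : Type*} [Field K] [Fintype ι] [DecidableEq ι] {d : ℕ} (hd : 2 ≤ d) {i j : ι}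
    (hij : i ≠ j) (hall : ∀ k, k = i ∨ k = j)
    (p : Fin d → K) (A B : K) (hf : qf i j p A B ≠ 0) (g s : MvPolynomial (ι × Fin d) K)
    (hg : ¬ IsUnit g) (h : qf i j p A B = g * s) (hk : kil i g ≠ 0) :
    g.totalDegree ≤ 1 ∧ B = 0 ∧ ∀ b, coeff (Finsupp.single (j, b) 1) g = 0 := by
  have hg0 : g ≠ 0 := by rintro rfl; simp at h; exact hf h
  have hs0 : s ≠ 0 := by rintro rfl; simp at h; exact hf h
  have hdeg := totalDegree_mul_of_isDomain hg0 hs0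
  rw [← h] at hdeg
  have h2 := qf_deg i j p A B
  have hks : kil i s = 0 := by
    have := congrArg (kil i) h
    rw [kil_qf_self, map_mul] at this
    exact (mul_eq_zero.1 this.symm).resolve_left hk
  have hs1 : s.totalDegree ≠ 0 := by
    intro h0
    obtain ⟨c, rfl⟩ := totalDegree_eq_zero_iff_eq_C.1 h0 |> fun h => (⟨_, h⟩ : ∃ c, s = C c)
    simp [kil] at hks
    exact hs0 (by simp [hks])
  have hg1 : g.totalDegree ≠ 0 := by
    intro h0
    rw [totalDegree_eq_zero_iff_eq_C] at h0
    rw [h0] at hg hg0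
    exact hg ((isUnit_iff_ne_zero.2 (by simpa using hg0)).map C)
  have hg2 : g.totalDegree ≤ 1 := by omega
  refine ⟨hg2, ?_⟩
  have rg := lin_repr g hg2
  have rs := lin_repr s (by omega)
  set c := coeff 0 g
  set m := fun u => coeff (Finsupp.single u 1) g with hm
  set c2 := coeff 0 s
  set l := fun u => coeff (Finsupp.single u 1) s with hl
  have ev : ∀ x y : Fin d → K, ∀ (f : ι × Fin d → K),
      ∑ u, f u * (if u.1 = i then x u.2 else y u.2) = ∑ k, f (i,k) * x k + ∑ k, f (j,k) * y k := by
    intro x y f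
    rw [Fintype.sum_prod_type, ← Finset.sum_subset (Finset.subset_univ {i, j}),
      Finset.sum_pair hij]
    · simp [hij.symm]
    · intro k _ hk; simp at hk; rcases hall k with h | h <;> tauto
  have evs : ∀ x y : Fin d → K, eval (fun u => if u.1 = i then x u.2 else y u.2) s =
      c2 + (∑ k, l (i,k) * x k + ∑ k, l (j,k) * y k) := by
    intro x y; conv_lhs => rw [rs]
    simp only [map_add, map_sum, map_mul, eval_C, eval_X]
    rw [ev x y l]
  have evg : ∀ x y : Fin d → K, eval (fun u => if u.1 = i then x u.2 else y u.2) g =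
      c + (∑ k, m (i,k) * x k + ∑ k, m (j,k) * y k) := by
    intro x y; conv_lhs => rw [rg]
    simp only [map_add, map_sum, map_mul, eval_C, eval_X]
    rw [ev x y m]
  have ev0 : ∀ y : Fin d → K, c2 + ∑ k, l (j,k) * y k = 0 := by
    intro y
    have := congrArg (eval (fun u => if u.1 = i then 0 else y u.2)) hks
    have h3 : eval (fun u => if u.1 = i then 0 else y u.2) (kil i s) =
      eval (fun u => if u.1 = i then 0 else y u.2) s := by
      rw [← coe_aeval_eq_eval, RingHom.coe_coe, kil, ← AlgHom.comp_apply]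
      congr 1
      ext u
      by_cases hu : u.1 = i <;> simp [hu]
    rw [h3] at this
    have h4 := evs 0 y
    simp only [Pi.zero_apply] at h4
    rw [h4] at this
    simpa using this
  have hc2 : c2 = 0 := by simpa using ev0 0
  have hlj : ∀ b, l (j,b) = 0 := by
    intro b
    have := ev0 (Pi.single b 1)
    simpa [hc2, Pi.single_apply] using this
  have evf : ∀ x y : Fin d → K, ∑ k, x k * (p k + A * x k + B * y k) =
      (c + (∑ k, m (i,k) * x k + ∑ k, m (j,k) * y k)) * ∑ k, l (i,k) * x k := by
    intro x y
    have h5 := congrArg (eval (fun u => if u.1 = i then x u.2 else y u.2)) h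
    rw [map_mul, evs, evg] at h5
    simpa [qf, hij.symm, hlj, hc2] using h5
  have evB : ∀ a b, (if a = b then B else 0) = m (j,b) * l (i,a) := by
    intro a b
    have h6 := evf (Pi.single a 1) (Pi.single b 1)
    have h7 := evf (Pi.single a 1) 0
    simp [Pi.single_apply] at h6 h7
    split_ifs at h6 ⊢ <;> linear_combination h6 - h7
  have hB : B = 0 := by
    have e00 := evB ⟨0, by omega⟩ ⟨0, by omega⟩
    have e01 := evB ⟨0, by omega⟩ ⟨1, by omega⟩
    have e11 := evB ⟨1, by omega⟩ ⟨1, by omega⟩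
    simp at e00 e01 e11
    rcases e01 with h | h
    · rw [e11, h, zero_mul]
    · rw [e00, h, mul_zero]
  refine ⟨hB, fun b => ?_⟩
  by_contra hb
  apply hs0
  have : ∀ a, l (i, a) = 0 := by
    intro a
    have := evB a b
    rw [hB] at this
    simp at this
    exact this.resolve_left hb
  rw [rs, hc2, C_0, zero_add]
  refine Finset.sum_eq_zero fun u _ => ?_
  have : l u = 0 := by
    rcases hall u.1 with h | h
    · rw [← this u.2, ← h]
    · rw [← hlj u.2, ← h]
  change C (l u) * X u = 0
  rw [this]; simp

theorem qf_ne {K ι : Type*} [Field K] [DecidableEq ι] {d : ℕ} (hd : 2 ≤ d) {i j : ι} (hij : i ≠ j)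
    (p : Fin d → K) (A B : K) (h : p ≠ 0 ∨ B ≠ 0) : qf i j p A B ≠ 0 := by
  by_cases hp : p = 0
  · have hB : B ≠ 0 := by simpa [hp] using h
    intro h0
    have h1 := congrArg (eval (fun u => if u.1 = i then (Pi.single ⟨0, by omega⟩ 1 : Fin d → K) u.2
      else (Pi.single ⟨0, by omega⟩ 1 : Fin d → K) u.2)) h0
    have h2 := congrArg (eval (fun u => if u.1 = i then (Pi.single ⟨0, by omega⟩ 1 : Fin d → K) u.2
      else 0)) h0
    simp [qf, hp, hij.symm, Pi.single_apply] at h1 h2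
    rw [h2] at h1; simp at h1; exact hB h1
  · intro h0
    exact kil_qf hij p hp A B (by rw [h0, map_zero])

theorem relprime {K ι : Type*} [Field K] [Fintype ι] [DecidableEq ι] {d : ℕ} (hd : 2 ≤ d) {i j : ι}
    (hij : i ≠ j) (hall : ∀ k, k = i ∨ k = j)
    (p r : Fin d → K) (A B C2 D : K) (h1 : p ≠ 0 ∨ B ≠ 0) (h2 : r ≠ 0 ∨ C2 ≠ 0)
    (h3 : p ≠ 0 ∨ r ≠ 0) : IsRelPrime (qf i j p A B) (qf j i r D C2) := by
  intro g ⟨s, hs⟩ ⟨t, ht⟩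
  by_contra hg
  have k1 : r ≠ 0 → _ := fun hr => key hd hij hall p A B (qf_ne hd hij _ _ _ h1) g s hg hs (by
    intro h0
    apply kil_qf hij.symm r hr D C2
    rw [ht, map_mul, h0, zero_mul])
  have k2 : p ≠ 0 → _ := fun hr => key hd hij.symm (fun k => (hall k).symm) r D C2
    (qf_ne hd hij.symm _ _ _ h2) g t hg ht (by
    intro h0
    apply kil_qf hij p hr A B
    rw [hs, map_mul, h0, zero_mul])
  by_cases hp : p = 0
  · have hr : r ≠ 0 := by simpa [hp] using h3
    have := (k1 hr).2.1
    simp_all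
  by_cases hr : r = 0
  · have := (k2 hp).2.1
    simp_all
  obtain ⟨hd1, -, a⟩ := k1 hr
  obtain ⟨-, -, b⟩ := k2 hp
  have rg := lin_repr g hd1
  rw [Finset.sum_eq_zero, add_zero] at rg
  · rw [rg] at hg hs
    apply hg
    refine (isUnit_iff_ne_zero.2 ?_).map C
    intro h0
    rw [h0] at hs
    simp at hs
    exact qf_ne hd hij _ _ _ h1 hs
  · rintro ⟨u, k⟩ _
    rcases hall u with rfl | rfl
    · simp [b]
    · simp [a]

theorem height_origin {K : Type*} [Field K] (σ : Type*) [Fintype σ] :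
    (Fintype.card σ : ℕ∞) ≤ (RingHom.ker (aeval (R := K) (fun _ : σ => (0 : K)))).height := by
  classical
  let e := Fintype.equivFin σ
  let φ : ℕ → (MvPolynomial σ K →ₐ[K] MvPolynomial σ K) := fun n =>
    aeval fun u => if (e u : ℕ) < n then 0 else X u
  have key : ∀ n ≤ Fintype.card σ, (n : ℕ∞) ≤ (RingHom.ker (φ n)).height := by
    intro n
    induction n with
    | zero => simp
    | succ n ih =>
      intro hn
      have := ih (by omega)
      have hlt : RingHom.ker (φ n) < RingHom.ker (φ (n+1)) := by
        refine lt_of_le_of_ne ?_ ?_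
        · intro f hf
          have hc : φ (n+1) = (φ (n+1)).comp (φ n) := by
            ext1 u
            by_cases hu : (e u : ℕ) < n
            · simp [φ, hu, hu.le]
            · simp [φ, hu]
          rw [RingHom.mem_ker] at hf ⊢
          rw [hc, AlgHom.comp_apply, hf, map_zero]
        · intro h
          have h1 : X (e.symm ⟨n, hn⟩) ∈ RingHom.ker (φ (n+1)) := by
            simp [RingHom.mem_ker, φ]
          rw [← h] at h1
          simp [RingHom.mem_ker, φ] at h1
      have i1 := RingHom.ker_isPrime (φ n)
      have i2 := RingHom.ker_isPrime (φ (n + 1))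
      have := Ideal.height_add_one_le_of_lt_of_isPrime hlt
      push_cast
      exact (by gcongr : (n : ℕ∞) + 1 ≤ _).trans this
  refine (key _ le_rfl).trans (Ideal.height_mono ?_)
  intro f hf
  have hc : aeval (R := K) (fun _ : σ => (0 : K)) =
      (aeval (R := K) (fun _ : σ => (0 : K))).comp (φ (Fintype.card σ)) := by
    ext1 u
    simp [φ]
  rw [RingHom.mem_ker] at hf ⊢
  rw [hc, AlgHom.comp_apply, hf, map_zero]

theorem dim_two {K : Type*} [Field K] [IsAlgClosed K] {σ : Type*} [Fintype σ]
    (f g : MvPolynomial σ K) (hfg : IsRelPrime f g) (hf : f ≠ 0)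
    (f0 : aeval (R := K) (fun _ : σ => (0 : K)) f = 0)
    (g0 : aeval (R := K) (fun _ : σ => (0 : K)) g = 0) (n : ℕ) (hn : Fintype.card σ = n + 2) :
    ringKrullDim (MvPolynomial σ K ⧸ (Ideal.span {f, g}).radical) = n := by
  have hrad : ringKrullDim (MvPolynomial σ K ⧸ (Ideal.span {f, g}).radical) =
      ringKrullDim (MvPolynomial σ K ⧸ Ideal.span {f, g}) := by
    rw [ringKrullDim_quotient, ringKrullDim_quotient, PrimeSpectrum.zeroLocus_radical]
  rw [hrad]
  have hdim : ringKrullDim (MvPolynomial σ K) = ((n + 2 : ℕ) : WithBot ℕ∞) := by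
    rw [MvPolynomial.ringKrullDim_of_isNoetherianRing, ringKrullDim_eq_zero_of_field,
      Nat.card_eq_fintype_card, hn, zero_add]
  have u1 : ringKrullDim (MvPolynomial σ K ⧸ Ideal.span {f}) + 1 ≤ ((n + 2 : ℕ) : WithBot ℕ∞) := by
    rw [← hdim]
    exact ringKrullDim_quotient_succ_le_of_nonZeroDivisor (mem_nonZeroDivisors_of_ne_zero hf)
  have hle : Ideal.span {f} ≤ Ideal.span {f, g} := Ideal.span_mono (by simp)
  have u2 : ringKrullDim (MvPolynomial σ K ⧸ Ideal.span {f, g}) + 1 ≤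
      ringKrullDim (MvPolynomial σ K ⧸ Ideal.span {f}) := by
    refine ringKrullDim_succ_le_of_surjective (Ideal.Quotient.factor hle)
      (Ideal.Quotient.factor_surjective hle) (r := Ideal.Quotient.mk _ g) ?_ ?_
    · rw [mem_nonZeroDivisors_iff_right]
      intro x hx
      obtain ⟨x, rfl⟩ := Ideal.Quotient.mk_surjective x
      rw [← map_mul, Ideal.Quotient.eq_zero_iff_mem, Ideal.mem_span_singleton] at hx
      rw [Ideal.Quotient.eq_zero_iff_mem, Ideal.mem_span_singleton]
      exact hfg.dvd_of_dvd_mul_right hx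
    · rw [Ideal.Quotient.factor_mk, Ideal.Quotient.eq_zero_iff_mem]
      exact Ideal.subset_span (by simp)
  have l1 : ((n + 2 : ℕ) : WithBot ℕ∞) ≤ ringKrullDim (MvPolynomial σ K ⧸ Ideal.span {f, g}) + 2 := by
    have i1 := RingHom.ker_isPrime (aeval (R := K) (fun _ : σ => (0 : K)))
    have := Ideal.height_le_ringKrullDim_quotient_add_encard
      (p := RingHom.ker (aeval (R := K) (fun _ : σ => (0 : K)))) {f, g} (by
        rintro x (rfl | rfl)
        · exact f0
        · exact g0)
    have h2 := height_origin (K := K) σ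
    rw [hn] at h2
    refine le_trans (WithBot.coe_le_coe.2 h2) (this.trans ?_)
    gcongr
    have := Set.encard_insert_le {g} f
    rw [Set.encard_singleton] at this
    exact WithBot.coe_le_coe.2 (this.trans_eq one_add_one_eq_two)
  generalize ringKrullDim (MvPolynomial σ K ⧸ Ideal.span {f, g}) = D at *
  generalize ringKrullDim (MvPolynomial σ K ⧸ Ideal.span {f}) = E at *
  have u3 : D + 1 + 1 ≤ ((n + 2 : ℕ) : WithBot ℕ∞) := le_trans (by gcongr) u1
  induction D using WithBot.recBotCoe with
  | bot => simp at l1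
  | coe D =>
    induction D using ENat.recTopCoe with
    | top => 
      exfalso
      have : ((⊤ : ℕ∞) + 1 + 1) ≤ ((n+2 : ℕ) : ℕ∞) := WithBot.coe_le_coe.1 u3
      simp at this
    | coe D =>
      have a1 : D + 1 + 1 ≤ n + 2 := by
        have : (D : ℕ∞) + 1 + 1 ≤ ((n + 2 : ℕ) : ℕ∞) := WithBot.coe_le_coe.1 u3
        exact_mod_cast this
      have a2 : n + 2 ≤ D + 2 := by
        have : ((n + 2 : ℕ) : ℕ∞) ≤ (D : ℕ∞) + 2 := WithBot.coe_le_coe.1 l1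
        exact_mod_cast this
      have : D = n := by omega
      subst this
      rfl

/-- the Main Conjecture in the case `N = 4`: for an irreducible skew-symmetric
`4 × 4` matrix `α` over an algebraically closed field and `(z₁,v) ∈ Q₁ ∩ A₂` with `z₁, v`
linearly independent, the set `Q(z₁,v) = {(z₂,z₃) ∈ K^{2d} : q₂ = q₃ = 0}` has Krull
dimension `2(d-1)`, i.e. codimension two in `K^{2d}`. -/
theorem stmt4 {K : Type*} [Field K] [IsAlgClosed K] {d : ℕ} (hd : 2 ≤ d)
    (α : Matrix (Fin 4) (Fin 4) K)
    (hskew : ∀ i j, α j i = -α i j)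
    (hent : ∀ i j, α i j = -1 ∨ α i j = 0 ∨ α i j = 1)
    (hrow : ∀ i, ∃ j, α i j ≠ 0)
    (h1N : α 0 3 = 1)
    (hirr : MatIrreducible α)
    (z1 v : Fin d → K)
    (hQ1 : ∑ k : Fin d, z1 k * v k = 0)
    (hz1 : z1 ≠ 0) (hv : v ≠ 0)
    (hli : LinearIndependent K ![z1, v]) :
    algSetDim K {w : Fin (4 - 2) × Fin d → K |
        ∀ j, MvPolynomial.eval w (qPoly 4 d α z1 v j) = 0} =
      ((2 * (d - 1) : ℕ) : WithBot ℕ∞) := by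
  have hpq : ∀ a b : K, (fun k => a * z1 k + b * v k) = 0 → a = 0 ∧ b = 0 := by
    intro a b h
    refine LinearIndependent.pair_iff.1 hli a b ?_
    ext k
    simpa using congrFun h k
  let i : Fin (4 - 2) := ⟨0, by norm_num⟩
  let j : Fin (4 - 2) := ⟨1, by norm_num⟩
  have hij : i ≠ j := by decide
  have hall : ∀ k, k = i ∨ k = j := by decide
  have hsum : ∀ F : Fin (4 - 2) → MvPolynomial (Fin (4 - 2) × Fin d) K,
      ∑ u, F u = F i + F j := fun F => Fin.sum_univ_two F
  have e1 : qPoly 4 d α z1 v i = qf i j (fun k => α 1 0 * z1 k + α 1 3 * v k)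
      (α 1 1 - α 1 3 * α 0 1) (α 1 2 - α 1 3 * α 0 2) := by
    unfold qPoly qf
    refine Finset.sum_congr rfl fun k _ => ?_
    rw [hsum, ← add_assoc]
    rfl
  have e2 : qPoly 4 d α z1 v j = qf j i (fun k => α 2 0 * z1 k + α 2 3 * v k)
      (α 2 2 - α 2 3 * α 0 2) (α 2 1 - α 2 3 * α 0 1) := by
    unfold qPoly qf
    refine Finset.sum_congr rfl fun k _ => ?_
    rw [hsum, add_comm (C _ * X (i, k)), ← add_assoc]
    rfl
  have h1 : (fun k => α 1 0 * z1 k + α 1 3 * v k) ≠ 0 ∨ α 1 2 - α 1 3 * α 0 2 ≠ 0 := by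
    by_contra! h
    obtain ⟨h0, h3⟩ := hpq _ _ h.1
    obtain ⟨a, ha, b, hb, hab⟩ := hirr {1} ⟨1, rfl⟩ ⟨0, by simp⟩
    have h2 := h.2
    rw [h3] at h2
    simp only [Set.mem_singleton_iff, Set.mem_compl_iff] at ha hb
    subst ha
    clear hskew hent hrow hirr hpq h e1 e2 hsum
    simp only [zero_mul, sub_zero] at h2
    fin_cases b
    · exact hab h0
    · exact hb rfl
    · exact hab h2
    · exact hab h3
  have h2 : (fun k => α 2 0 * z1 k + α 2 3 * v k) ≠ 0 ∨ α 2 1 - α 2 3 * α 0 1 ≠ 0 := by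
    by_contra! h
    obtain ⟨h0, h3⟩ := hpq _ _ h.1
    obtain ⟨a, ha, b, hb, hab⟩ := hirr {2} ⟨2, rfl⟩ ⟨0, by simp⟩
    have h2 := h.2
    rw [h3] at h2
    simp only [Set.mem_singleton_iff, Set.mem_compl_iff] at ha hb
    subst ha
    clear hskew hent hrow hirr hpq h e1 e2 hsum
    simp only [zero_mul, sub_zero] at h2
    fin_cases b
    · exact hab h0
    · exact hab h2
    · exact hb rfl
    · exact hab h3
  have h3 : (fun k => α 1 0 * z1 k + α 1 3 * v k) ≠ 0 ∨
      (fun k => α 2 0 * z1 k + α 2 3 * v k) ≠ 0 := by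
    by_contra! h
    obtain ⟨h0, h3⟩ := hpq _ _ h.1
    obtain ⟨h00, h33⟩ := hpq _ _ h.2
    obtain ⟨a, ha, b, hb, hab⟩ := hirr {1, 2} ⟨1, by simp⟩ ⟨0, by simp⟩
    clear hskew hent hrow hirr h
    simp only [Set.mem_insert_iff, Set.mem_singleton_iff, Set.mem_compl_iff] at ha hb
    rcases ha with rfl | rfl <;> fin_cases b
    · exact hab h0
    · exact hb (Or.inl rfl)
    · exact hb (Or.inr rfl)
    · exact hab h3
    · exact hab h00
    · exact hb (Or.inl rfl)
    · exact hb (Or.inr rfl)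
    · exact hab h33
  have hrel := relprime hd hij hall _ _ (α 1 1 - α 1 3 * α 0 1) _ _ (α 2 2 - α 2 3 * α 0 2) h1 h2 h3
  rw [← e1, ← e2] at hrel
  have hne : qPoly 4 d α z1 v i ≠ 0 := by
    rw [e1]; exact qf_ne hd hij _ _ _ h1
  have hset : {w : Fin (4 - 2) × Fin d → K |
        ∀ j, MvPolynomial.eval w (qPoly 4 d α z1 v j) = 0} =
      zeroLocus K (Ideal.span {qPoly 4 d α z1 v i, qPoly 4 d α z1 v j}) := by
    rw [zeroLocus_span]
    ext w
    simp only [Set.mem_setOf_eq, Set.mem_insert_iff, Set.mem_singleton_iff, forall_eq_or_imp,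
      forall_eq, aeval_eq_eval]
    constructor
    · intro h; exact ⟨h i, h j⟩
    · intro h k
      rcases hall k with rfl | rfl
      · exact h.1
      · exact h.2
  rw [algSetDim, hset, vanishingIdeal_zeroLocus_eq_radical]
  refine dim_two _ _ hrel hne ?_ ?_ _ ?_
  · rw [e1]; simp [qf]
  · rw [e2]; simp [qf]
  · simp only [Fintype.card_prod, Fintype.card_fin]
    omega
end

section
/- Let K be an algebraically closed field and let q₁, q₂ ∈ K[x₁,…,x_n] be two linearly independent polynomials of degree two. Set 𝒬₁ = {x ∈ K^n : q₁(x) = 0} and 𝒬₂ = {x ∈ K^n : q₂(x) = 0}. Then the intersection 𝒬₁ ∩ 𝒬₂ has codimension one in K^n (i.e. Krull dimension n − 1) if and only if q₁ and q₂ have a common affine linear (degree-one) factor l(x). -/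
open MvPolynomial

/-- Every maximal ideal of a polynomial ring in `n` variables over a field has height `n`. -/
lemma height_of_isMaximal_aux {K : Type*} [Field K] (n : ℕ) :
    ∀ M : Ideal (MvPolynomial (Fin n) K), M.IsMaximal → M.height = n := by
  induction n with
  | zero =>
    intro M hM
    have h1 := Ideal.height_le_ringKrullDim_of_ne_top hM.ne_top
    rw [MvPolynomial.ringKrullDim_of_isNoetherianRing, ringKrullDim_eq_zero_of_field] at h1
    simpa using h1
  | succ n ih =>
    intro M hM
    let e := (finSuccEquiv K n).toRingEquiv
    have hmax : (M.map e).IsMaximal := Ideal.map_isMaximal_of_equiv e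
    have h1 := Polynomial.isMaximal_comap_C_of_isJacobsonRing (M.map e)
    generalize hP : M.map e = P at hmax h1
    have hlo : P.LiesOver (P.comap (Polynomial.C : MvPolynomial (Fin n) K →+* _)) := ⟨rfl⟩
    have h2 := Polynomial.height_eq_height_add_one
      (P.comap (Polynomial.C : MvPolynomial (Fin n) K →+* _)) P
    rw [← hP, RingEquiv.height_map, hP] at h2
    rw [h2, ih _ h1]
    simp

lemma add_one_le_cancel_aux {d : WithBot ℕ∞} {m : ℕ}
    (h : d + 1 ≤ ((m + 1 : ℕ) : WithBot ℕ∞)) : d ≤ (m : WithBot ℕ∞) := by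
  induction d with
  | bot => exact bot_le
  | coe d =>
    induction d with
    | top => 
      have h' : ((⊤ + 1 : ℕ∞) : WithBot ℕ∞) ≤ (((m + 1 : ℕ) : ℕ∞) : WithBot ℕ∞) := h
      rw [WithBot.coe_le_coe, top_add, top_le_iff] at h'
      exact absurd h' (ENat.coe_ne_top _)
    | coe d =>
      norm_cast at h ⊢
      omega

lemma le_add_one_cancel_aux {d : WithBot ℕ∞} {m : ℕ}
    (h : ((m + 1 : ℕ) : WithBot ℕ∞) ≤ d + 1) : (m : WithBot ℕ∞) ≤ d := by
  induction d with
  | bot => simp at h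
  | coe d =>
    induction d with
    | top => exact le_top
    | coe d =>
      norm_cast at h ⊢
      omega

theorem stmt5 {K : Type*} [Field K] [IsAlgClosed K] (n : ℕ)
    (q₁ q₂ : MvPolynomial (Fin n) K)
    (hq₁ : q₁.totalDegree = 2) (hq₂ : q₂.totalDegree = 2)
    (hli : LinearIndependent K ![q₁, q₂]) :
    algSetDim K {x : Fin n → K | eval x q₁ = 0 ∧ eval x q₂ = 0} = ((n - 1 : ℕ) : WithBot ℕ∞)
      ↔ ∃ l : MvPolynomial (Fin n) K, l.totalDegree = 1 ∧ l ∣ q₁ ∧ l ∣ q₂ := by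
  have h1 : q₁ ≠ 0 := by rintro rfl; simp at hq₁
  have h2 : q₂ ≠ 0 := by rintro rfl; simp at hq₂
  obtain ⟨m, rfl⟩ : ∃ m, n = m + 1 := by
    cases n with
    | zero =>
      rw [MvPolynomial.eq_C_of_isEmpty q₁] at hq₁
      simp at hq₁
    | succ m => exact ⟨m, rfl⟩
  have hdim : ringKrullDim (MvPolynomial (Fin (m + 1)) K) = ((m + 1 : ℕ) : WithBot ℕ∞) := by
    rw [MvPolynomial.ringKrullDim_of_isNoetherianRing, ringKrullDim_eq_zero_of_field]
    simp
  unfold algSetDim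
  set X : Set (Fin (m + 1) → K) := {x | eval x q₁ = 0 ∧ eval x q₂ = 0} with hX
  have hm1 : q₁ ∈ vanishingIdeal K X := fun x hx => hx.1
  have hm2 : q₂ ∈ vanishingIdeal K X := fun x hx => hx.2
  simp only [Nat.add_sub_cancel]
  constructor
  · intro hd
    by_contra hcon
    have hrel : IsRelPrime q₁ q₂ := by
      refine WfDvdMonoid.isRelPrime_of_no_irreducible_factors (fun h => h1 h.1) ?_
      intro z hz hz1 hz2
      obtain ⟨a, ha⟩ := hz1
      obtain ⟨b, hb⟩ := hz2
      have ha0 : a ≠ 0 := by rintro rfl; simp [h1] at ha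
      have hb0 : b ≠ 0 := by rintro rfl; simp [h2] at hb
      have da := totalDegree_mul_of_isDomain hz.ne_zero ha0
      have db := totalDegree_mul_of_isDomain hz.ne_zero hb0
      rw [← ha, hq₁] at da
      rw [← hb, hq₂] at db
      have hz1 : z.totalDegree ≠ 1 := fun h => hcon ⟨z, h, ⟨a, ha⟩, ⟨b, hb⟩⟩
      have hz0 : z.totalDegree ≠ 0 := by
        intro h
        rw [totalDegree_eq_zero_iff_eq_C] at h
        apply hz.not_isUnit
        have hc : coeff 0 z ≠ 0 := by
          intro h'
          rw [h'] at h
          exact hz.ne_zero (by simpa using h)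
        rw [h]
        exact (isUnit_iff_ne_zero.mpr hc).map C
      have a0 : a.totalDegree = 0 := by omega
      have b0 : b.totalDegree = 0 := by omega
      rw [totalDegree_eq_zero_iff_eq_C] at a0 b0
      rw [LinearIndependent.pair_iff] at hli
      have := hli (coeff 0 b) (-coeff 0 a) (by
        rw [ha, hb, smul_eq_C_mul, smul_eq_C_mul, C_neg, ← a0, ← b0]; ring)
      apply hb0
      rw [b0, this.1, C_0]
    have s1 := ringKrullDim_quotient_succ_le_of_nonZeroDivisor (mem_nonZeroDivisors_of_ne_zero h1)
    have hle : Ideal.span {q₁} ≤ vanishingIdeal K X := by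
      rwa [Ideal.span_singleton_le_iff_mem]
    have s2 := ringKrullDim_succ_le_of_surjective (Ideal.Quotient.factor hle)
      (Ideal.Quotient.factor_surjective hle) (r := Ideal.Quotient.mk _ q₂)
      (by
        rw [mem_nonZeroDivisors_iff_right]
        intro x hx
        obtain ⟨x, rfl⟩ := Ideal.Quotient.mk_surjective x
        rw [← map_mul, Ideal.Quotient.eq_zero_iff_mem, Ideal.mem_span_singleton] at hx
        rw [Ideal.Quotient.eq_zero_iff_mem, Ideal.mem_span_singleton]
        exact hrel.dvd_of_dvd_mul_right hx)
      (by
        rw [Ideal.Quotient.factor_mk]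
        exact Ideal.Quotient.eq_zero_iff_mem.mpr hm2)
    rw [hd] at s2
    rw [hdim] at s1
    have s3 := s2.trans (add_one_le_cancel_aux s1)
    norm_cast at s3
    omega
  · rintro ⟨l, hl, hl1, hl2⟩
    have hl0 : l ≠ 0 := by rintro rfl; simp at hl
    have hirr : Irreducible l := by
      refine irreducible_of_totalDegree_eq_one hl ?_
      intro x hx
      rw [isUnit_iff_ne_zero]
      rintro rfl
      exact hl0 (by ext i; simpa using hx i)
    have hprime : (Ideal.span {l}).IsPrime :=
      (Ideal.span_singleton_prime hl0).mpr hirr.prime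
    have hle : vanishingIdeal K X ≤ Ideal.span {l} := by
      rw [← IsPrime.vanishingIdeal_zeroLocus (K := K) (Ideal.span {l})]
      apply vanishingIdeal_anti_mono
      intro x hx
      rw [zeroLocus_span] at hx
      have hxl : eval x l = 0 := hx l rfl
      exact ⟨by obtain ⟨a, rfl⟩ := hl1; simp [hxl], by obtain ⟨a, rfl⟩ := hl2; simp [hxl]⟩
    apply le_antisymm
    · apply add_one_le_cancel_aux
      rw [← hdim]
      exact ringKrullDim_succ_le_of_surjective (Ideal.Quotient.mk _)
        Ideal.Quotient.mk_surjective (mem_nonZeroDivisors_of_ne_zero h1)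
        (Ideal.Quotient.eq_zero_iff_mem.mpr hm1)
    · refine le_trans ?_ (ringKrullDim_le_of_surjective (Ideal.Quotient.factor hle)
        (Ideal.Quotient.factor_surjective hle))
      obtain ⟨M, hM, hlM⟩ := Ideal.exists_le_maximal _ hprime.ne_top
      have := Ideal.height_le_ringKrullDim_quotient_add_one
        ((Ideal.span_singleton_le_iff_mem _).mp hlM)
      rw [height_of_isMaximal_aux _ M hM] at this
      exact le_add_one_cancel_aux this
end

section
/- Let p be a prime, K the algebraic closure of the finite field F_p, and let F₁,…,F_s ∈ K[X₁,…,X_n] be nonzero polynomials with deg F_i = d_i. Let X = {x ∈ K^n : F_i(x) = 0 for all i} and suppose X has Krull dimension r. Then the number of F_p-points of X satisfies |X ∩ F_p^n| ≤ p^r · Π_{i=1}^s d_i. -/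
open MvPolynomial

lemma height_poly_step {A : Type*} [CommRing A] [IsNoetherianRing A] (Q : Ideal (Polynomial A))
    [Q.IsPrime] : (Q.under A).height ≤ Q.height ∧
      (Q ≠ (Q.under A).map Polynomial.C → (Q.under A).height + 1 ≤ Q.height) := by
  have h := Ideal.height_eq_height_add_of_liesOver_of_hasGoingDown (Q.under A) Q
  refine ⟨by rw [h]; exact le_self_add, fun hne => ?_⟩
  rw [h]
  gcongr
  set J := (Q.under A).map (algebraMap A (Polynomial A)) with hJ
  have hJQ : J ≤ Q := Ideal.map_comap_le
  have hJp : J.IsPrime := by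
    have := Ideal.isPrime_map_C_of_isPrime (P := Q.under A)
    exact this
  have hlt : J < Q := lt_of_le_of_ne hJQ (fun h' => hne h'.symm)
  have : (Q.map (Ideal.Quotient.mk J)).IsPrime :=
    Ideal.map_isPrime_of_surjective Ideal.Quotient.mk_surjective (by simpa using hJQ)
  have hbot : (Q.map (Ideal.Quotient.mk J)) ≠ ⊥ := by
    intro h0
    apply hlt.not_ge
    rw [Ideal.map_eq_bot_iff_le_ker] at h0
    simpa using h0
  rw [Order.one_le_iff_ne_zero]
  intro h0
  exact hbot (Ideal.height_eq_zero_iff_eq_bot.1 h0)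

lemma exists_indep (k : Type*) [Field k] (n : ℕ) (P : Ideal (MvPolynomial (Fin n) k)) [P.IsPrime] :
    ∃ m : ℕ, (n : ℕ∞) ≤ m + P.height ∧
      ∃ φ : MvPolynomial (Fin m) k →ₐ[k] MvPolynomial (Fin n) k, ∀ f, φ f ∈ P → f = 0 := by
  induction n with
  | zero =>
    refine ⟨0, by simp, AlgHom.id _ _, fun f hf => ?_⟩
    by_contra h
    rw [eq_C_of_isEmpty f] at h hf
    have hc : coeff 0 f ≠ 0 := fun h0 => h (by simp [h0])
    exact (Ideal.IsPrime.ne_top ‹P.IsPrime›) (Ideal.eq_top_of_isUnit_mem _ hf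
      ((IsUnit.mk0 _ hc).map C))
  | succ n ih =>
    let e := finSuccEquiv k n
    let Q : Ideal (Polynomial (MvPolynomial (Fin n) k)) := P.map e.toRingEquiv
    have hQ : Q.IsPrime := Ideal.map_isPrime_of_equiv e.toRingEquiv
    have hmem : ∀ f, f ∈ Q → e.symm f ∈ P := by
      intro f hf
      obtain ⟨x, hx, rfl⟩ := (Ideal.mem_map_of_equiv e.toRingEquiv f).1 hf
      simpa using hx
    have hht : Q.height = P.height := e.toRingEquiv.height_map P
    have hmem' : ∀ f, e.symm f ∈ P → f ∈ Q := by
      intro f hf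
      have := Ideal.mem_map_of_mem e.toRingEquiv hf
      simpa using this
    obtain ⟨m, hm, φ, hφ⟩ := ih (Q.under _)
    obtain ⟨h1, h2⟩ := height_poly_step Q
    by_cases hq : Q = (Q.under _).map Polynomial.C
    · refine ⟨m + 1, ?_, (e.symm.toAlgHom.comp (Polynomial.mapAlgHom φ)).comp
        (finSuccEquiv k m).toAlgHom, fun f hf => ?_⟩
      · push_cast
        rw [← hht, add_right_comm]
        gcongr
        exact hm.trans (by gcongr)
      · have := hmem' _ hf
        rw [hq, Ideal.mem_map_C_iff] at this
        apply (finSuccEquiv k m).injective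
        rw [map_zero]
        ext1 i
        have h3 := this i
        have h4 : φ ((finSuccEquiv k m f).coeff i) ∈ Q.under _ := by
          simpa using h3
        simpa using hφ _ h4
    · refine ⟨m, ?_, (e.symm.toAlgHom.restrictScalars k).comp
        ((Algebra.ofId _ _ : MvPolynomial (Fin n) k →ₐ[MvPolynomial (Fin n) k] _).restrictScalars k |>.comp φ), fun f hf => ?_⟩
      · push_cast
        rw [← hht]
        calc (n : ℕ∞) + 1 ≤ m + (Q.under _).height + 1 := by gcongr
          _ = m + ((Q.under _).height + 1) := by rw [add_assoc]
          _ ≤ _ := by gcongr; exact h2 hq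
      · exact hφ _ (hmem' _ hf)

lemma dim_integral {A B : Type*} [CommRing A] [CommRing B] [IsDomain A] [IsDomain B] [Algebra A B]
    [FaithfulSMul A B]
    [Algebra.IsIntegral A B] : ringKrullDim A ≤ ringKrullDim B := by
  unfold ringKrullDim Order.krullDim
  apply iSup_le
  intro l
  obtain ⟨P, -, hP, hPc⟩ := Ideal.exists_ideal_over_prime_of_isIntegral (S := B) l.head.asIdeal ⊥ (by
    rw [← RingHom.ker_eq_comap_bot, (RingHom.injective_iff_ker_eq_bot _).1 (FaithfulSMul.algebraMap_injective A B)]; exact bot_le)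
  have : P.LiesOver l.head.asIdeal := ⟨hPc.symm⟩
  obtain ⟨L, hL, -⟩ := Ideal.exists_ltSeries_of_hasGoingUp l P
  rw [← hL]
  exact le_iSup (fun l : LTSeries (PrimeSpectrum B) => (l.length : WithBot ℕ∞)) L

lemma height_dim (k : Type) [Field k] (n r : ℕ) (P : Ideal (MvPolynomial (Fin n) k)) [P.IsPrime]
    (hr : ringKrullDim (MvPolynomial (Fin n) k ⧸ P) ≤ r) : (n : ℕ∞) ≤ r + P.height := by
  obtain ⟨m, hm, φ, hφ⟩ := exists_indep k n P
  refine hm.trans ?_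
  gcongr
  obtain ⟨d, -, g, hg, hgi⟩ := exists_integral_inj_algHom_of_quotient P (Ideal.IsPrime.ne_top ‹_›)
  let B := MvPolynomial (Fin n) k ⧸ P
  let ψ : MvPolynomial (Fin m) k →ₐ[k] B := (Ideal.Quotient.mkₐ k P).comp φ
  have hψ : Function.Injective ψ := by
    rw [injective_iff_map_eq_zero]
    intro f hf
    exact hφ f (Ideal.Quotient.eq_zero_iff_mem.1 hf)
  let _ := g.toRingHom.toAlgebra
  have : IsScalarTower k (MvPolynomial (Fin d) k) B := IsScalarTower.of_algHom g
  have : Algebra.IsIntegral (MvPolynomial (Fin d) k) B := ⟨hgi⟩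
  have : FaithfulSMul (MvPolynomial (Fin d) k) B :=
    (faithfulSMul_iff_algebraMap_injective _ _).2 hg
  have h1 : ringKrullDim (MvPolynomial (Fin d) k) ≤ ringKrullDim B := dim_integral
  have hdr : d ≤ r := by
    have := h1.trans hr
    simp at this
    exact_mod_cast this
  have hmd : m ≤ d := by
    have h2 : Algebra.trdeg k (MvPolynomial (Fin d) k) = Algebra.trdeg k B := by
      have := trdeg_add_eq k (MvPolynomial (Fin d) k) (A := B)
      rw [trdeg_eq_zero (R := MvPolynomial (Fin d) k), add_zero] at this
      exact this
    have h3 := trdeg_le_of_injective ψ hψ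
    rw [← h2] at h3
    simpa using h3
  exact hmd.trans hdr

/-- affine Hilbert function of an ideal -/
noncomputable def hilb {k : Type} [Field k] {n : ℕ} (I : Ideal (MvPolynomial (Fin n) k)) (D : ℕ) : ℕ :=
  Module.finrank k ((restrictTotalDegree (Fin n) k D).map (Ideal.Quotient.mkₐ k I).toLinearMap)

section
variable {k : Type} [Field k] {n : ℕ}

lemma hilb_mono_ideal {I J : Ideal (MvPolynomial (Fin n) k)} (h : I ≤ J) (D : ℕ) :
    hilb J D ≤ hilb I D := by
  unfold hilb
  have : (restrictTotalDegree (Fin n) k D).map (Ideal.Quotient.mkₐ k J).toLinearMap =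
    ((restrictTotalDegree (Fin n) k D).map (Ideal.Quotient.mkₐ k I).toLinearMap).map
      (Ideal.Quotient.factorₐ k h).toLinearMap := by
    rw [← Submodule.map_comp]
    rfl
  rw [this]
  exact Submodule.finrank_map_le _ _

lemma hilb_step {I J : Ideal (MvPolynomial (Fin n) k)} (h : I ≤ J) (g : MvPolynomial (Fin n) k)
    (hgJ : g ∈ J) (hg : ∀ f, g * f ∈ I → f ∈ I) (d D : ℕ) (hd : g.totalDegree ≤ d) :
    hilb J (D + d) + hilb I D ≤ hilb I (D + d) := by
  let R := MvPolynomial (Fin n) k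
  let W := (restrictTotalDegree (Fin n) k (D + d)).map (Ideal.Quotient.mkₐ k I).toLinearMap
  let V := (restrictTotalDegree (Fin n) k D).map (Ideal.Quotient.mkₐ k I).toLinearMap
  let q : (R ⧸ I) →ₗ[k] (R ⧸ J) := (Ideal.Quotient.factorₐ k h).toLinearMap
  let mu : (R ⧸ I) →ₗ[k] (R ⧸ I) := LinearMap.mulLeft k (Ideal.Quotient.mk I g)
  have hmu : Function.Injective mu := by
    rw [injective_iff_map_eq_zero]
    intro x hx
    obtain ⟨f, rfl⟩ := Ideal.Quotient.mk_surjective x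
    have : Ideal.Quotient.mk I (g * f) = 0 := by simpa [mu] using hx
    exact Ideal.Quotient.eq_zero_iff_mem.2 (hg f (Ideal.Quotient.eq_zero_iff_mem.1 this))
  have h1 : Module.finrank k (W.map q) = hilb J (D + d) := by
    unfold hilb
    rw [← Submodule.map_comp]
    rfl
  have h2 : Module.finrank k (V.map mu) = hilb I D :=
    (Submodule.equivMapOfInjective mu hmu V).finrank_eq.symm
  have h3 : V.map mu ≤ W ⊓ LinearMap.ker q := by
    rintro _ ⟨_, ⟨f, hf, rfl⟩, rfl⟩
    have hf' : f.totalDegree ≤ D := (mem_restrictTotalDegree _ _ _).1 hf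
    refine ⟨⟨g * f, ?_, ?_⟩, ?_⟩
    · refine (mem_restrictTotalDegree _ _ _).2 ?_
      have := totalDegree_mul g f
      omega
    · simp [mu]
    · change Ideal.Quotient.factor h (Ideal.Quotient.mk I g * Ideal.Quotient.mk I f) = 0
      rw [map_mul, Ideal.Quotient.factor_mk, Ideal.Quotient.eq_zero_iff_mem.2 hgJ, zero_mul]
  have h4 := LinearMap.finrank_range_add_finrank_ker (q.domRestrict W)
  have h5 : LinearMap.range (q.domRestrict W) = W.map q := by
    rw [LinearMap.range_domRestrict]
  rw [h5, h1] at h4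
  have h6 : Module.finrank k (V.map mu) ≤ Module.finrank k (LinearMap.ker (q.domRestrict W)) := by
    have : (LinearMap.ker (q.domRestrict W)).map W.subtype = W ⊓ LinearMap.ker q := by
      rw [LinearMap.ker_domRestrict]
      exact Submodule.map_comap_subtype _ _
    rw [← Submodule.finrank_map_subtype_eq, this]
    exact Submodule.finrank_mono h3
  rw [h2] at h6
  refine le_trans ?_ (le_of_eq h4)
  gcongr

lemma hilb_bot_le (D : ℕ) :
    (hilb (⊥ : Ideal (MvPolynomial (Fin n) k)) D : ℝ) ≤ (D + n) ^ n / n.factorial := by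
  have h1 : hilb (⊥ : Ideal (MvPolynomial (Fin n) k)) D ≤ 
     Module.finrank k (restrictTotalDegree (Fin n) k D) := Submodule.finrank_map_le _ _
  have h2 : Module.finrank k (restrictTotalDegree (Fin n) k D) ≤ (D + n).choose n := by
    have hb := Module.finrank_eq_nat_card_basis
      (basisRestrictSupport k {s : Fin n →₀ ℕ | s.sum (fun _ e ↦ e) ≤ D})
    refine (le_of_eq hb).trans ?_
    let T := (Finset.univ : Finset (Fin (n + 1))).finsuppAntidiag D
    have hT : Nat.card T = (D + n).choose n := by
      rw [Nat.card_eq_fintype_card, Fintype.card_coe, Finset.card_finsuppAntidiag_nat_eq_choose]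
      simp only [Finset.card_univ, Fintype.card_fin]
      rw [show n + 1 + D - 1 = D + n by omega, Nat.choose_symm_add]
    rw [← hT]
    let ι : {s : Fin n →₀ ℕ | s.sum (fun _ e ↦ e) ≤ D} → T := fun s =>
      ⟨Finsupp.cons (D - s.1.sum (fun _ e ↦ e)) s.1, by
        have := s.2
        simp only [Set.mem_ofPred_eq] at this
        simp only [T, Finset.mem_finsuppAntidiag, Finset.subset_univ, and_true, Fin.sum_univ_succ,
          Finsupp.cons_zero, Finsupp.cons_succ]
        rw [Finsupp.sum_fintype _ _ (by simp)] at this ⊢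
        omega⟩
    refine Nat.card_le_card_of_injective ι ?_
    intro s t hst
    have h3 := congrArg (fun x : T => x.1.tail) hst
    simp only [ι, Finsupp.tail_cons] at h3
    exact Subtype.ext h3
  calc (hilb (⊥ : Ideal (MvPolynomial (Fin n) k)) D : ℝ) ≤ ((D + n).choose n : ℕ) := by
        exact_mod_cast h1.trans h2
    _ ≤ _ := by
      have := Nat.choose_le_pow_div (α := ℝ) n (D + n)
      push_cast at this
      exact this

def Bd (I : Ideal (MvPolynomial (Fin n) k)) (m : ℕ) (a : ℝ) : Prop :=
  ∃ D0 : ℕ, ∀ u : ℕ, a * (u : ℝ) ^ m / m.factorial ≤ hilb I (D0 + u)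

lemma Bd.mono {I : Ideal (MvPolynomial (Fin n) k)} {m : ℕ} {a b : ℝ} (h : Bd I m a) (hab : b ≤ a) :
    Bd I m b := by
  obtain ⟨D0, h⟩ := h
  refine ⟨D0, fun u => le_trans ?_ (h u)⟩
  gcongr

lemma Bd_zero (I : Ideal (MvPolynomial (Fin n) k)) (m : ℕ) : Bd I m 0 :=
  ⟨0, fun u => by simp⟩

lemma Bd.step {I J : Ideal (MvPolynomial (Fin n) k)} (h : I ≤ J) (g : MvPolynomial (Fin n) k)
    (hgJ : g ∈ J) (hg : ∀ f, g * f ∈ I → f ∈ I) (d : ℕ) (hd : g.totalDegree ≤ d) (hd0 : 0 < d)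
    (m : ℕ) (a : ℝ) (ha : 0 ≤ a) (hb : Bd J m a) : Bd I (m + 1) (a / d) := by
  obtain ⟨D0, hb⟩ := hb
  refine ⟨D0, fun u => ?_⟩
  have hdR : (0 : ℝ) < d := by exact_mod_cast hd0
  induction u using Nat.strong_induction_on with
  | _ u ih =>
    have hfac : ((m + 1).factorial : ℝ) = (m + 1) * m.factorial := by
      rw [Nat.factorial_succ]; push_cast; ring
    have hfp : (0 : ℝ) < m.factorial := by exact_mod_cast m.factorial_pos
    by_cases hu : u < d
    · have hu' : (u : ℝ) ≤ d := by exact_mod_cast hu.le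
      refine le_trans ?_ ((hb u).trans (by exact_mod_cast hilb_mono_ideal h _))
      rw [hfac, div_mul_eq_mul_div, div_div, div_le_div_iff₀ (by positivity) (by positivity)]
      have : (u : ℝ) ^ (m + 1) ≤ u ^ m * (d * (m + 1)) := by
        rw [pow_succ]
        gcongr
        nlinarith [(Nat.cast_nonneg m : (0 : ℝ) ≤ m)]
      nlinarith [mul_le_mul_of_nonneg_left this (mul_nonneg ha hfp.le)]
    · push Not at hu
      obtain ⟨v, rfl⟩ := Nat.exists_eq_add_of_le' hu
      have h1 := ih v (by omega)
      have h2 := hb (v + d)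
      have h3 := hilb_step h g hgJ hg d (D0 + v) hd
      rw [add_assoc] at h3
      have h3' : (hilb J (D0 + (v + d)) : ℝ) + hilb I (D0 + v) ≤ hilb I (D0 + (v + d)) := by
        exact_mod_cast h3
      refine le_trans ?_ h3'
      refine le_trans ?_ (add_le_add h2 h1)
      push_cast
      have hv : (0 : ℝ) ≤ v := Nat.cast_nonneg _
      set w : ℝ := (v : ℝ) + d with hw
      have hwp : 0 < w := by linarith
      have hbern : w ^ (m + 1) ≤ (m + 1) * d * w ^ m + (v : ℝ) ^ (m + 1) := by
        have hB := one_add_mul_le_pow (a := -(d / w)) (by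
          have : d / w ≤ 1 := by rw [div_le_one hwp]; linarith
          linarith) (m + 1)
        have hvw : (v : ℝ) = w * (1 + -(d / w)) := by field_simp; linarith
        rw [hvw, mul_pow]
        have := mul_le_mul_of_nonneg_left hB (pow_nonneg hwp.le (m + 1))
        refine le_trans (le_of_eq ?_) (add_le_add_right this _)
        push_cast
        field_simp
        ring
      rw [hfac]
      have e1 : a / d * w ^ (m + 1) / ((m + 1) * m.factorial) =
        a / (d * ((m + 1) * m.factorial)) * w ^ (m + 1) := by field_simp
      have e2 : a * w ^ m / m.factorial + a / d * (v : ℝ) ^ (m + 1) / ((m + 1) * m.factorial) =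
        a / (d * ((m + 1) * m.factorial)) * ((m + 1) * d * w ^ m + (v : ℝ) ^ (m + 1)) := by
        field_simp
      rw [e1, e2]
      gcongr

lemma Bd_bot (a : ℝ) (h : Bd (⊥ : Ideal (MvPolynomial (Fin n) k)) n a) : a ≤ 1 := by
  obtain ⟨D0, h⟩ := h
  have h1 : ∀ u : ℕ, a * (u : ℝ) ^ n ≤ (u + (D0 + n)) ^ n := by
    intro u
    have h2 := (h u).trans (hilb_bot_le _)
    rw [div_le_div_iff_of_pos_right (by exact_mod_cast n.factorial_pos)] at h2
    refine h2.trans (le_of_eq ?_)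
    push_cast
    ring
  have h2 : Filter.Tendsto (fun u : ℕ => (1 + (D0 + n : ℝ) / u) ^ n) Filter.atTop (nhds ((1 + 0) ^ n)) := by
    refine Filter.Tendsto.pow ?_ n
    exact tendsto_const_nhds.add (tendsto_const_div_atTop_nhds_zero_nat _)
  rw [add_zero, one_pow] at h2
  refine ge_of_tendsto h2 ?_
  filter_upwards [Filter.eventually_gt_atTop 0] with u hu
  have hu' : (0 : ℝ) < u := by exact_mod_cast hu
  have h3 := h1 u
  have : (1 + (D0 + n : ℝ) / u) = (u + (D0 + n)) / u := by field_simp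
  rw [this, div_pow, le_div_iff₀ (by positivity)]
  exact h3
end

section
variable {k : Type} [Field k] {n : ℕ}

lemma nzd_of_avoid {R : Type*} [CommRing R] {I : Ideal R} (hI : I.IsRadical) (g : R)
    (hg : ∀ P ∈ I.minimalPrimes, g ∉ P) (f : R) (h : g * f ∈ I) : f ∈ I := by
  rw [← hI.radical, ← Ideal.sInf_minimalPrimes, Ideal.mem_sInf]
  intro P hP
  have hPp : P.IsPrime := hP.1.1
  exact (hPp.mem_or_mem (hP.1.2 h)).resolve_left (hg P hP)

lemma exists_avoid [Infinite k] {ι : Type} [Fintype ι] (F : ι → MvPolynomial (Fin n) k)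
    (T : Finset ι) (i₀ : ι) (I : Ideal (MvPolynomial (Fin n) k))
    (h : ∀ P ∈ I.minimalPrimes, ∃ i ∈ T, F i ∉ P) :
    ∃ c : ι → k, c i₀ ≠ 0 ∧ ∀ P ∈ I.minimalPrimes, ∑ i ∈ T, c i • F i ∉ P := by
  classical
  have hfin : (I.minimalPrimes).Finite := I.finite_minimalPrimes_of_isNoetherianRing
  have : Finite I.minimalPrimes := hfin
  let L : (ι → k) →ₗ[k] MvPolynomial (Fin n) k := ∑ i ∈ T, (LinearMap.proj i).smulRight (F i)
  have hL : ∀ c, L c = ∑ i ∈ T, c i • F i := by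
    intro c; simp [L]
  let U : Option I.minimalPrimes → Subspace k (ι → k) := fun o =>
    match o with
    | none => LinearMap.ker (LinearMap.proj i₀ : (ι → k) →ₗ[k] k)
    | some P => (P.1.restrictScalars k).comap L
  by_contra hcon
  push Not at hcon
  have hcov : ⋃ o, (U o : Set (ι → k)) = Set.univ := by
    rw [Set.eq_univ_iff_forall]
    intro c
    rw [Set.mem_iUnion]
    by_cases h0 : c i₀ = 0
    · exact ⟨none, by simpa [U] using h0⟩
    · obtain ⟨P, hP, hc⟩ := hcon c h0
      refine ⟨some ⟨P, hP⟩, ?_⟩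
      change L c ∈ P
      rwa [hL]
  obtain ⟨o, ho⟩ := Subspace.exists_eq_top_of_iUnion_eq_univ hcov
  rcases o with _ | ⟨P, hP⟩
  · have : (Pi.single i₀ 1 : ι → k) ∈ U none := by rw [ho]; trivial
    simp [U] at this
  · obtain ⟨i, hiT, hi⟩ := h P hP
    have : (Pi.single i 1 : ι → k) ∈ U (some ⟨P, hP⟩) := by rw [ho]; trivial
    change L _ ∈ P at this
    rw [hL, Finset.sum_eq_single i] at this
    · simp at this
      exact hi this
    · intro j _ hj
      simp [Pi.single_eq_of_ne hj]
    · exact fun h => absurd hiT h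

lemma exists_interp (Z : Finset (Fin n → k)) (z : Fin n → k) :
    ∃ l : MvPolynomial (Fin n) k, eval z l = 1 ∧ ∀ w ∈ Z, w ≠ z → eval w l = 0 := by
  classical
  have h : ∀ w : Fin n → k, ∃ l : MvPolynomial (Fin n) k, eval z l = 1 ∧ (w ≠ z → eval w l = 0) := by
    intro w
    by_cases hw : w = z
    · exact ⟨1, by simp, fun h => absurd hw h⟩
    · obtain ⟨i, hi⟩ := Function.ne_iff.1 hw
      have : z i - w i ≠ 0 := sub_ne_zero.2 (Ne.symm hi)
      exact ⟨C (z i - w i)⁻¹ * (X i - C (w i)), by simp [this], fun _ => by simp⟩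
  choose l h1 h2 using h
  refine ⟨∏ w ∈ Z, l w, by simp [h1], fun w hw hne => ?_⟩
  rw [map_prod]
  exact Finset.prod_eq_zero hw (h2 w hne)

lemma Bd_base (Z : Finset (Fin n → k)) (I : Ideal (MvPolynomial (Fin n) k))
    (hI : ∀ f ∈ I, ∀ z ∈ Z, eval z f = 0) : Bd I 0 (Z.card : ℝ) := by
  classical
  choose l h1 h2 using exists_interp (k := k) Z
  let E : MvPolynomial (Fin n) k →ₐ[k] (Z → k) := Pi.algHom k _ (fun z => aeval z.1)
  have hE : ∀ f z, E f z = eval z.1 f := fun f z => by simp [E, aeval_eq_eval]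
  have hEI : ∀ f ∈ I, E f = 0 := by
    intro f hf
    ext z
    rw [hE]
    exact hI f hf _ z.2
  let E' := Ideal.Quotient.liftₐ I E hEI
  refine ⟨Z.sup (fun z => (l z).totalDegree), fun u => ?_⟩
  simp only [pow_zero, mul_one, Nat.factorial_zero, Nat.cast_one, div_one, Nat.cast_le]
  set D := Z.sup (fun z => (l z).totalDegree) + u with hD
  have htop : ((restrictTotalDegree (Fin n) k D).map (Ideal.Quotient.mkₐ k I).toLinearMap).map
      E'.toLinearMap = ⊤ := by
    rw [← Submodule.map_comp, eq_top_iff]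
    intro v _
    refine ⟨∑ z : Z, v z • l z.1, ?_, ?_⟩
    · apply Submodule.sum_mem
      intro z _
      apply Submodule.smul_mem
      rw [mem_restrictTotalDegree]
      have := Finset.le_sup (f := fun z => (l z).totalDegree) z.2
      omega
    · change E (∑ z : Z, v z • l z.1) = v
      ext w
      rw [hE, map_sum, Finset.sum_eq_single w]
      · simp [smul_eval, h1]
      · intro z _ hz
        simp only [smul_eval]
        rw [h2 z.1 w.1 w.2 (fun h => hz (Subtype.ext h.symm)), mul_zero]
      · simp
  have h3 : Module.finrank k (((restrictTotalDegree (Fin n) k D).map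
    (Ideal.Quotient.mkₐ k I).toLinearMap).map E'.toLinearMap) ≤ hilb I D :=
    Submodule.finrank_map_le _ _
  rw [htop, finrank_top] at h3
  simpa using h3

lemma height_of_frob (p : ℕ) (hp : 2 ≤ p) (P : Ideal (MvPolynomial (Fin n) k)) [P.IsPrime]
    (h : ∀ i, (X i ^ p - X i : MvPolynomial (Fin n) k) ∈ P) : (n : ℕ∞) ≤ P.height := by
  have hIntegral : Algebra.IsIntegral k (MvPolynomial (Fin n) k ⧸ P) := by
    refine ⟨fun x => ?_⟩
    obtain ⟨f, rfl⟩ := Ideal.Quotient.mk_surjective x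
    induction f using MvPolynomial.induction_on with
    | C a => exact isIntegral_algebraMap (R := k) (x := a)
    | add f g hf hg => rw [map_add]; exact hf.add hg
    | mul_X f i hf =>
      rw [map_mul]
      refine hf.mul ⟨Polynomial.X ^ p - Polynomial.X, ?_, ?_⟩
      · exact Polynomial.monic_X_pow_sub (by simpa using Nat.lt_of_lt_of_le one_lt_two hp)
      · simpa using Ideal.Quotient.eq_zero_iff_mem.2 (h i)
  have hf : IsField (MvPolynomial (Fin n) k ⧸ P) :=
    isField_of_isIntegral_of_isField' (Field.toIsField k)
  have := height_dim k n 0 P (by simp [ringKrullDim_eq_zero_of_isField hf])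
  simpa using this

lemma span_insert_radical_step (S : Finset (MvPolynomial (Fin n) k)) [DecidableEq (MvPolynomial (Fin n) k)]
    (g : MvPolynomial (Fin n) k)
    (hg : ∀ P ∈ (Ideal.span (S : Set (MvPolynomial (Fin n) k))).radical.minimalPrimes, g ∉ P)
    (d : ℕ) (hd : g.totalDegree ≤ d) (hd0 : 0 < d) (m : ℕ) (a : ℝ) (ha : 0 ≤ a)
    (hb : Bd (Ideal.span ((insert g S : Finset _) : Set (MvPolynomial (Fin n) k))).radical m a) :
    Bd (Ideal.span (S : Set (MvPolynomial (Fin n) k))).radical (m + 1) (a / d) := by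
  refine Bd.step ?_ g ?_ (nzd_of_avoid (Ideal.radical_isRadical _) g hg) d hd hd0 m a ha hb
  · exact Ideal.radical_mono (Ideal.span_mono (by simp))
  · exact Ideal.le_radical (Ideal.subset_span (by simp))

lemma height_min (S : Finset (MvPolynomial (Fin n) k)) (P : Ideal (MvPolynomial (Fin n) k))
    (hP : P ∈ (Ideal.span (S : Set (MvPolynomial (Fin n) k))).radical.minimalPrimes) :
    P.height ≤ S.card := by
  rw [Ideal.radical_minimalPrimes] at hP
  exact Ideal.height_le_card_of_mem_minimalPrimes_span_finset hP

lemma stage2 [Infinite k] (p : ℕ) (hp : 2 ≤ p) (Z : Finset (Fin n → k))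
    (hZ : ∀ z ∈ Z, ∀ i, z i ^ p = z i) (m : ℕ) :
    ∀ S : Finset (MvPolynomial (Fin n) k), S.card + m ≤ n → (∀ f ∈ S, ∀ z ∈ Z, eval z f = 0) →
      Bd (Ideal.span (S : Set (MvPolynomial (Fin n) k))).radical m ((Z.card : ℝ) / (p : ℝ) ^ m) := by
  classical
  induction m with
  | zero =>
    intro S _ hS
    rw [pow_zero, div_one]
    apply Bd_base
    intro f hf z hz
    obtain ⟨j, hj⟩ := hf
    have h1 : Ideal.span (S : Set (MvPolynomial (Fin n) k)) ≤ RingHom.ker (eval z) := by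
      rw [Ideal.span_le]
      exact fun f hf => hS f hf z hz
    have h2 := h1 hj
    rw [RingHom.mem_ker, map_pow] at h2
    exact eq_zero_of_pow_eq_zero h2
  | succ m ih =>
    intro S hc hS
    let F : Fin n → MvPolynomial (Fin n) k := fun i => X i ^ p - X i
    obtain ⟨c, -, hav⟩ := exists_avoid F Finset.univ ⟨0, by omega⟩
      (Ideal.span (S : Set (MvPolynomial (Fin n) k))).radical (by
        intro P hP
        by_contra hcon
        push Not at hcon
        have hPp : P.IsPrime := hP.1.1
        have h1 := height_of_frob p hp P (fun i => hcon i (Finset.mem_univ _))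
        have h2 := h1.trans (height_min S P hP)
        have h3 : n ≤ S.card := by exact_mod_cast h2
        omega)
    set g := ∑ i, c i • F i with hg
    have hgd : g.totalDegree ≤ p := by
      refine totalDegree_finsetSum_le (fun i _ => ?_)
      refine (totalDegree_smul_le _ _).trans ?_
      refine (totalDegree_sub _ _).trans (max_le ?_ ?_)
      · simp
      · simp; omega
    have := span_insert_radical_step S g hav p hgd (by omega) m _ (by positivity)
      (ih (insert g S) (by have := Finset.card_insert_le g S; omega) (by
        intro f hf z hz
        rcases Finset.mem_insert.1 hf with rfl | hf
        · simp [hg, F, smul_eval, hZ z hz]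
        · exact hS f hf z hz))
    rwa [div_div, ← pow_succ] at this

lemma stage1 [Infinite k] (p : ℕ) (hp : 2 ≤ p) (Z : Finset (Fin n → k))
    (hZ : ∀ z ∈ Z, ∀ i, z i ^ p = z i) {ι : Type} [Fintype ι] [DecidableEq ι]
    (F : ι → MvPolynomial (Fin n) k) (hFd : ∀ i, 0 < (F i).totalDegree)
    (hFZ : ∀ i, ∀ z ∈ Z, eval z (F i) = 0) (r : ℕ)
    (hr : ∀ P : Ideal (MvPolynomial (Fin n) k), P.IsPrime → (∀ i, F i ∈ P) →
      (n : ℕ∞) ≤ r + P.height) (t : ℕ) :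
    ∀ (S : Finset (MvPolynomial (Fin n) k)) (T : Finset ι), S.card + r + t ≤ n →
      (∀ f ∈ S, ∀ z ∈ Z, eval z f = 0) →
      (∀ P : Ideal (MvPolynomial (Fin n) k), (∀ f ∈ S, f ∈ P) → (∀ i ∈ T, F i ∈ P) → ∀ i, F i ∈ P) →
      Bd (Ideal.span (S : Set (MvPolynomial (Fin n) k))).radical (r + t)
        ((Z.card : ℝ) / (p : ℝ) ^ r / ∏ i ∈ T, ((F i).totalDegree : ℝ)) := by
  classical
  have hFR : ∀ i, (1 : ℝ) ≤ (F i).totalDegree := fun i => by exact_mod_cast hFd i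
  induction t with
  | zero =>
    intro S T hc hS _
    refine (stage2 p hp Z hZ r S (by omega) hS).mono ?_
    exact div_le_self (by positivity) (by exact_mod_cast Nat.succ_le_of_lt (Finset.prod_pos fun i _ => hFd i))
  | succ t ih =>
    intro S T hc hS hT
    have hmin : ∀ P ∈ (Ideal.span (S : Set (MvPolynomial (Fin n) k))).radical.minimalPrimes,
        ∃ i ∈ T, F i ∉ P := by
      intro P hP
      by_contra hcon
      push Not at hcon
      have hSP : ∀ f ∈ S, f ∈ P := fun f hf => hP.1.2 (Ideal.le_radical (Ideal.subset_span hf))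
      have h1 := hr P hP.1.1 (hT P hSP hcon)
      have h2 := h1.trans (add_le_add_right (height_min S P hP) _)
      have h3 : n ≤ r + S.card := by exact_mod_cast h2
      omega
    rcases T.eq_empty_or_nonempty with rfl | hTne
    · have hnone : (Ideal.span (S : Set (MvPolynomial (Fin n) k))).radical.minimalPrimes = ∅ := by
        rw [Set.eq_empty_iff_forall_notMem]
        intro P hP
        obtain ⟨i, hi, -⟩ := hmin P hP
        simp at hi
      have hZ0 : Z = ∅ := by
        rw [Finset.eq_empty_iff_forall_notMem]
        intro z hz
        have h1 : (Ideal.span (S : Set (MvPolynomial (Fin n) k))).radical = ⊤ := by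
          rw [← Ideal.radical_idem, ← Ideal.sInf_minimalPrimes, hnone, sInf_empty]
        rw [Ideal.radical_eq_top] at h1
        have h2 : Ideal.span (S : Set (MvPolynomial (Fin n) k)) ≤ RingHom.ker (eval z) := by
          rw [Ideal.span_le]
          exact fun f hf => hS f hf z hz
        rw [h1, top_le_iff] at h2
        exact RingHom.ker_ne_top _ h2
      simp only [hZ0, Finset.card_empty, Nat.cast_zero, zero_div]
      exact Bd_zero _ _
    · obtain ⟨i₀, hi₀, hmax⟩ := Finset.exists_max_image T (fun i => (F i).totalDegree) hTne
      obtain ⟨c, hc0, hav⟩ := exists_avoid F T i₀ _ hmin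
      set g := ∑ i ∈ T, c i • F i with hg
      have hgd : g.totalDegree ≤ (F i₀).totalDegree :=
        totalDegree_finsetSum_le (fun i hi => (totalDegree_smul_le _ _).trans (hmax i hi))
      have := span_insert_radical_step S g hav _ hgd (hFd i₀) (r + t) _ (by positivity)
        (ih (insert g S) (T.erase i₀) (by have := Finset.card_insert_le g S; omega) (by
          intro f hf z hz
          rcases Finset.mem_insert.1 hf with rfl | hf
          · simp [hg, smul_eval, hFZ _ z hz]
          · exact hS f hf z hz) (by
          intro P hSP hTP
          refine hT P (fun f hf => hSP f (Finset.mem_insert_of_mem hf)) (fun i hi => ?_)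
          by_cases hii : i = i₀
          · subst hii
            have hgP := hSP g (Finset.mem_insert_self _ _)
            rw [hg, ← Finset.add_sum_erase T _ hi] at hgP
            have hsum : ∑ x ∈ T.erase i, c x • F x ∈ P :=
              Ideal.sum_mem _ (fun j hj => by
                rw [smul_eq_C_mul]; exact P.mul_mem_left _ (hTP j hj))
            have h1 := (Ideal.add_mem_iff_left P hsum).1 hgP
            have h2 := P.mul_mem_left (C (c i)⁻¹) h1
            rwa [smul_eq_C_mul, ← mul_assoc, ← C_mul, inv_mul_cancel₀ hc0, C_1, one_mul] at h2
          · exact hTP i (Finset.mem_erase.2 ⟨hii, hi⟩)))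
      rwa [div_div _ (∏ i ∈ T.erase i₀, _), Finset.prod_erase_mul _ _ hi₀] at this

end

theorem stmt11 (p : ℕ) [Fact p.Prime] (n s : ℕ)
    (F : Fin s → MvPolynomial (Fin n) (AlgebraicClosure (ZMod p)))
    (hF : ∀ i, F i ≠ 0) (r : ℕ)
    (X : Set (Fin n → AlgebraicClosure (ZMod p)))
    (hX : X = {x | ∀ i, eval x (F i) = 0})
    (hdim : ringKrullDim
        (MvPolynomial (Fin n) (AlgebraicClosure (ZMod p)) ⧸
          MvPolynomial.vanishingIdeal (AlgebraicClosure (ZMod p)) X) = ((r : ℕ) : WithBot ℕ∞)) :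
    (X ∩ {x | ∀ i, x i ∈
        Set.range (algebraMap (ZMod p) (AlgebraicClosure (ZMod p)))}).Finite ∧
      (X ∩ {x | ∀ i, x i ∈
          Set.range (algebraMap (ZMod p) (AlgebraicClosure (ZMod p)))}).ncard ≤
        p ^ r * ∏ i, (F i).totalDegree := by
  classical
  have hp2 : 2 ≤ p := (Fact.out : p.Prime).two_le
  have hinf : Infinite (AlgebraicClosure (ZMod p)) := IsAlgClosed.instInfinite
  set Y := X ∩ {x | ∀ i, x i ∈ Set.range (algebraMap (ZMod p) (AlgebraicClosure (ZMod p)))} with hY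
  have hfin : Y.Finite := by
    refine (Set.finite_range (fun (y : Fin n → ZMod p) i => algebraMap (ZMod p) (AlgebraicClosure (ZMod p)) (y i))).subset ?_
    rintro x ⟨-, hx⟩
    choose y hy using hx
    exact ⟨y, funext hy⟩
  refine ⟨hfin, ?_⟩
  by_cases hdeg : ∃ i, (F i).totalDegree = 0
  · obtain ⟨i, hi⟩ := hdeg
    have : Y = ∅ := by
      rw [Set.eq_empty_iff_forall_notMem]
      rintro x ⟨hx, -⟩
      rw [hX] at hx
      have hxi := hx i
      rw [totalDegree_eq_zero_iff_eq_C.1 hi, eval_C] at hxi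
      apply hF i
      rw [totalDegree_eq_zero_iff_eq_C.1 hi, hxi, C_0]
    simp [this]
  push Not at hdeg
  have hFd : ∀ i, 0 < (F i).totalDegree := fun i => Nat.pos_of_ne_zero (hdeg i)
  have hXl : X = zeroLocus (AlgebraicClosure (ZMod p)) (Ideal.span (Set.range F)) := by
    rw [hX, zeroLocus_span]
    ext x
    simp [aeval_eq_eval]
  have hprime : ∀ P : Ideal (MvPolynomial (Fin n) (AlgebraicClosure (ZMod p))), P.IsPrime → (∀ i, F i ∈ P) →
      (n : ℕ∞) ≤ r + P.height := by
    intro P hP hFP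
    apply height_dim
    rw [← hdim]
    have hle : vanishingIdeal (AlgebraicClosure (ZMod p)) X ≤ P := by
      rw [hXl, vanishingIdeal_zeroLocus_eq_radical]
      refine (hP.isRadical.radical_le_iff).2 (Ideal.span_le.2 ?_)
      rintro _ ⟨i, rfl⟩
      exact hFP i
    exact ringKrullDim_le_of_surjective (Ideal.Quotient.factor hle)
      (Ideal.Quotient.factor_surjective hle)
  have hrn : r ≤ n := by
    have h1 := ringKrullDim_quotient_le (vanishingIdeal (AlgebraicClosure (ZMod p)) X)
    rw [hdim] at h1
    simp at h1
    exact_mod_cast h1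
  have hmain := stage1 p hp2 hfin.toFinset (by
      intro z hz i
      obtain ⟨-, hz⟩ := hfin.mem_toFinset.1 hz
      obtain ⟨a, ha⟩ := hz i
      rw [← ha, ← map_pow, ZMod.pow_card]) F hFd (by
      intro i z hz
      obtain ⟨hz, -⟩ := hfin.mem_toFinset.1 hz
      rw [hX] at hz
      exact hz i) r hprime (n - r) ∅ Finset.univ (by simp; omega) (by simp)
      (fun P _ h i => h i (Finset.mem_univ _))
  have hrad : (Ideal.span ((∅ : Finset (MvPolynomial (Fin n) (AlgebraicClosure (ZMod p)))) : Set (MvPolynomial (Fin n) (AlgebraicClosure (ZMod p))))).radical = ⊥ := by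
    simp
  rw [hrad, Nat.add_sub_cancel' hrn] at hmain
  have h1 := Bd_bot _ hmain
  have hpp : (0 : ℝ) < (p : ℝ) ^ r := by positivity
  have hdp : (0 : ℝ) < ∏ i, ((F i).totalDegree : ℝ) :=
    Finset.prod_pos (fun i _ => by exact_mod_cast hFd i)
  rw [div_div, div_le_one (by positivity)] at h1
  rw [Set.ncard_eq_toFinset_card Y hfin]
  exact_mod_cast h1
end

section
/- Let m ≥ s ≥ 1 be integers and let q₁,…,q_s ∈ ℤ[X₁,…,X_m] be polynomials of degree at most two with q_i(0) = 0 for each i. Let Q = {x ∈ ℝ^m : q_i(x) = 0 for all i} and, for M ≥ 1, let S_m(M,Q) = Q ∩ ℤ^m ∩ (−M,M)^m. Let p be a prime with p > 2M, let q_i^{(p)} ∈ F_p[X₁,…,X_m] be the reduction of q_i modulo p, and let Q^{(p)} = {x ∈ K^m : q_i^{(p)}(x) = 0 for all i}, where K = F̄_p. If Q^{(p)} has Krull dimension m − s, then |S_m(M,Q)| ≤ 2^s p^{m−s}. -/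
open MvPolynomial

lemma aux_height_pt {m : ℕ} {K : Type*} [Field K] [IsAlgClosed K] (x : Fin m → K) :
    (vanishingIdeal K {x} : Ideal (MvPolynomial (Fin m) K)).height = m := by
  have hdim : ringKrullDim (MvPolynomial (Fin m) K) = m := by
    rw [MvPolynomial.ringKrullDim_of_isNoetherianRing]; simp
  have hfin : FiniteRingKrullDim (MvPolynomial (Fin m) K) := by
    rw [finiteRingKrullDim_iff_ne_bot_and_top, hdim]
    exact ⟨by simp, by exact fun h => by simpa using WithBot.coe_injective h⟩
  obtain ⟨I, hI, hh⟩ := Ideal.exists_isMaximal_height (R := MvPolynomial (Fin m) K)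
  obtain ⟨y, rfl⟩ := isMaximal_iff_eq_vanishingIdeal_singleton.1 hI
  let e : MvPolynomial (Fin m) K ≃ₐ[K] MvPolynomial (Fin m) K :=
    AlgEquiv.ofAlgHom (aeval fun i => X i + C (y i - x i)) (aeval fun i => X i - C (y i - x i))
      (by ext i; simp) (by ext i; simp)
  have key : (vanishingIdeal K {x} : Ideal (MvPolynomial (Fin m) K)) 
      = (vanishingIdeal K {y}).comap e.symm.toRingEquiv := by
    ext p
    simp only [mem_vanishingIdeal_singleton_iff, Ideal.mem_comap]
    have : (aeval y) (e.symm.toRingEquiv p) = aeval x p := by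
      change ((aeval y).comp (aeval fun i => X i - C (y i - x i))) p = _
      congr 1
      ext i; simp
    rw [this]
  rw [key, RingEquiv.height_comap]
  rw [hdim] at hh
  exact_mod_cast hh

/-- A family of univariate polynomials killed modulo suitable primes vanishes. -/
lemma aux_uni {m : ℕ} {K : Type*} [Field K] [DecidableEq K] (S : Finset (Fin m → K))
    (g : S → MvPolynomial (Fin m) K)
    (hg : ∀ x y : S, aeval y.1 (g x) = if x = y then (1 : K) else 0)
    (t : MvPolynomial (Fin m) K) (ht : ∀ y : S, aeval y.1 t = 0)
    (P : S → Ideal (MvPolynomial (Fin m) K)) (hP : ∀ y, (P y).IsPrime)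
    (hPle : ∀ y, P y ≤ vanishingIdeal K {y.1}) (htP : ∀ y, t ∉ P y)
    (n : ℕ) : ∀ (w : S → Polynomial K),
      (∀ y, ∑ x, Polynomial.aeval t (w x) * g x ∈ P y) → ∀ x, Polynomial.X ^ n ∣ w x := by
  induction n with
  | zero => intro w _ x; simp
  | succ n ih =>
    intro w hw
    have h0 : ∀ x, Polynomial.X ∣ w x := by
      intro x
      rw [Polynomial.X_dvd_iff, Polynomial.coeff_zero_eq_eval_zero]
      have := hPle x (hw x)
      rw [mem_vanishingIdeal_singleton_iff, map_sum] at this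
      simp only [map_mul, hg, ← Polynomial.aeval_algHom_apply, ht] at this
      simpa [Polynomial.coe_aeval_eq_eval] using this
    choose w' hw' using h0
    have := ih w' (fun y => by
      have h1 := hw y
      have h2 : ∑ x, Polynomial.aeval t (w x) * g x = t * ∑ x, Polynomial.aeval t (w' x) * g x := by
        rw [Finset.mul_sum]
        refine Finset.sum_congr rfl fun x _ => ?_
        rw [hw' x]; simp; ring
      rw [h2] at h1
      exact ((hP y).mem_or_mem h1).resolve_left (htP y))
    intro x
    rw [hw' x, pow_succ']
    exact mul_dvd_mul_left _ (this x)

lemma aux_indep {m : ℕ} (hm : 0 < m) {K : Type*} [Field K] [IsAlgClosed K] [DecidableEq K] (S : Finset (Fin m → K))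
    (f : Fin m → MvPolynomial (Fin m) K) (hS : ∀ x ∈ S, ∀ i, aeval x (f i) = 0)
    (hmax : ∀ P : Ideal (MvPolynomial (Fin m) K), P.IsPrime → (∀ i, f i ∈ P) → P.IsMaximal)
    (g : S → MvPolynomial (Fin m) K)
    (hg : ∀ x y : S, aeval y.1 (g x) = if x = y then (1 : K) else 0)
    (P : S → MvPolynomial (Fin m) K) (hP : ∑ x, aeval f (P x) * g x = 0) : ∀ x, P x = 0 := by
  by_contra! hcon
  obtain ⟨x0, hx0⟩ := hcon
  have : Infinite K := IsAlgClosed.instInfinite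
  let b : Fin m := ⟨0, hm⟩
  obtain ⟨c, hc⟩ : ∃ c : Fin m → K, eval c (P x0 * X b) ≠ 0 := by
    by_contra! h
    have : P x0 * X b = 0 := MvPolynomial.funext (by simpa using h)
    rcases mul_eq_zero.1 this with h | h
    · exact hx0 h
    · exact X_ne_zero b h
  simp only [map_mul, eval_X, mul_ne_zero_iff] at hc
  obtain ⟨hc0, hcb⟩ := hc
  set t : MvPolynomial (Fin m) K := C (c b)⁻¹ * f b with htdef
  have htb : C (c b) * t = f b := by
    rw [htdef, ← mul_assoc, ← C_mul, mul_inv_cancel₀ hcb]; simp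
  let s : Finset (MvPolynomial (Fin m) K) := by
    classical exact (Finset.univ.erase b).image (fun a => f a - C (c a) * t)
  have hscard : s.card < m := by
    refine lt_of_le_of_lt Finset.card_image_le ?_
    rw [Finset.card_erase_of_mem (Finset.mem_univ _)]
    simp; omega
  have ht : ∀ y : S, aeval y.1 t = 0 := by
    intro y; rw [htdef, map_mul, hS y.1 y.2 b, mul_zero]
  have hJ : ∀ y : S, Ideal.span (s : Set (MvPolynomial (Fin m) K)) ≤ vanishingIdeal K {y.1} := by
    intro y
    rw [Ideal.span_le]
    intro z hz
    simp only [s, Finset.coe_image, Set.mem_image] at hz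
    obtain ⟨a, -, rfl⟩ := hz
    rw [SetLike.mem_coe, mem_vanishingIdeal_singleton_iff]
    rw [map_sub, map_mul, hS y.1 y.2 a, ht y]; simp
  have hex : ∀ y : S, ∃ p ∈ (Ideal.span (s : Set (MvPolynomial (Fin m) K))).minimalPrimes,
      p ≤ vanishingIdeal K {y.1} := fun y => Ideal.exists_minimalPrimes_le (hJ y)
  choose Q hQ hQle using hex
  have hQp : ∀ y, (Q y).IsPrime := fun y => (hQ y).1.1
  have hmem : ∀ y a, f a - C (c a) * t ∈ Q y := by
    intro y a
    by_cases hab : a = b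
    · rw [hab, htb, sub_self]; exact zero_mem _
    · refine (hQ y).1.2 (Ideal.subset_span ?_)
      simp only [s, Finset.coe_image, Set.mem_image]
      exact ⟨a, by simp [hab], rfl⟩
  have htQ : ∀ y, t ∉ Q y := by
    intro y hty
    have h1 : ∀ a, f a ∈ Q y := fun a => by
      have := (Q y).add_mem (hmem y a) ((Q y).mul_mem_left (C (c a)) hty)
      simpa using this
    have h2 := hmax _ (hQp y) h1
    have h3 : Q y = vanishingIdeal K {y.1} :=
      h2.eq_of_le (Ideal.IsPrime.ne_top inferInstance) (hQle y)
    have h4 := Ideal.height_le_card_of_mem_minimalPrimes_span_finset (hQ y)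
    rw [h3, aux_height_pt] at h4
    have : m ≤ s.card := by exact_mod_cast h4
    omega
  let w : S → Polynomial K := fun x => aeval (fun i => Polynomial.C (c i) * Polynomial.X) (P x)
  have hrel : ∀ y x, Ideal.Quotient.mk (Q y) (Polynomial.aeval t (w x)) =
      Ideal.Quotient.mk (Q y) (aeval f (P x)) := by
    intro y x
    have h1 : ((Ideal.Quotient.mkₐ K (Q y)).comp ((Polynomial.aeval t).comp
        (aeval (fun i => Polynomial.C (c i) * Polynomial.X)))) =
        (Ideal.Quotient.mkₐ K (Q y)).comp (aeval f) := by
      ext i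
      simp only [AlgHom.comp_apply, aeval_X, map_mul, Polynomial.aeval_X, Polynomial.aeval_C]
      rw [← map_mul]
      symm
      exact (Ideal.Quotient.eq).2 (hmem y i)
    exact DFunLike.congr_fun h1 (P x)
  have hw : ∀ y, ∑ x, Polynomial.aeval t (w x) * g x ∈ Q y := by
    intro y
    rw [← Ideal.Quotient.eq_zero_iff_mem, map_sum]
    simp only [map_mul, hrel]
    simp only [← map_mul]
    rw [← map_sum, hP, map_zero]
  have hdvd : ∀ n, Polynomial.X ^ n ∣ w x0 := fun n =>
    aux_uni S g hg t ht Q hQp hQle htQ n w hw x0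
  have hw0 : w x0 = 0 := by
    ext n
    have := Polynomial.X_pow_dvd_iff.1 (hdvd (n+1)) n (by omega)
    simpa using this
  apply hc0
  have h2 : Polynomial.eval 1 (w x0) = eval c (P x0) := by
    have : (Polynomial.aeval (1:K)).comp (aeval (fun i => Polynomial.C (c i) * Polynomial.X)) =
      (aeval c : MvPolynomial (Fin m) K →ₐ[K] K) := by ext i; simp
    have := DFunLike.congr_fun this (P x0)
    simpa [w, Polynomial.coe_aeval_eq_eval, MvPolynomial.coe_aeval_eq_eval] using this
  rw [← h2, hw0]; simp


/-- Exponent vectors of weighted degree at most `d`. -/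
def auxJ {m : ℕ} (e : Fin m → ℕ) (d : ℕ) : Set (Fin m →₀ ℕ) := {j | ∑ i, j i * e i ≤ d}

/-- Exponent vectors of degree at most `d`. -/
def auxT (m d : ℕ) : Set (Fin m →₀ ℕ) := {n | (n.sum fun _ e => e) ≤ d}

lemma auxT_eq (m d : ℕ) : auxT m d = auxJ (fun _ => 1) d := by
  ext n
  simp only [auxT, auxJ, Set.mem_ofPred_eq, mul_one]
  rw [Finsupp.sum_fintype _ _ (fun _ => rfl)]

lemma auxJ_sub {m : ℕ} (e : Fin m → ℕ) (he : ∀ i, 0 < e i) (d : ℕ) {j : Fin m →₀ ℕ} (hj : j ∈ auxJ e d)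
    (i : Fin m) : j i < d + 1 := by
  have h1 : j i * e i ≤ ∑ i, j i * e i :=
    Finset.single_le_sum (f := fun i => j i * e i) (fun _ _ => Nat.zero_le _) (Finset.mem_univ i)
  have h2 : j i ≤ j i * e i := Nat.le_mul_of_pos_right _ (he i)
  have h3 : ∑ i, j i * e i ≤ d := hj
  omega

lemma auxJ_finite {m : ℕ} (e : Fin m → ℕ) (he : ∀ i, 0 < e i) (d : ℕ) : Finite (auxJ e d) := by
  refine Finite.of_injective (β := Fin m → Fin (d+1))
    (fun j i => ⟨j.1 i, auxJ_sub e he d j.2 i⟩) ?_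
  intro a b h
  ext i
  simpa using congrFun h i

lemma auxT_card_le (m d : ℕ) : Nat.card (auxT m d) ≤ (d + 1) ^ m := by
  rw [auxT_eq]
  have := Nat.card_le_card_of_injective (β := Fin m → Fin (d+1))
    (fun j : auxJ (fun _ : Fin m => 1) d => fun i => ⟨j.1 i, auxJ_sub _ (by simp) d j.2 i⟩) (by
      intro a b h
      ext i
      simpa using congrFun h i)
  simpa using this

lemma auxT_card_pos (m d : ℕ) : 0 < Nat.card (auxT m d) := by
  have : Finite (auxT m d) := by rw [auxT_eq]; exact auxJ_finite _ (by simp) d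
  have : Nonempty (auxT m d) := ⟨⟨0, by simp [auxT]⟩⟩
  exact Nat.card_pos

lemma auxT_le_J {m : ℕ} (e : Fin m → ℕ) (he : ∀ i, 0 < e i) (d : ℕ) :
    Nat.card (auxT m d) ≤ (∏ i, e i) * Nat.card (auxJ e d) := by
  have := auxJ_finite e he d
  have h := Nat.card_le_card_of_injective (α := auxT m d) (β := ((i : Fin m) → Fin (e i)) × auxJ e d)
    (fun a => (fun i => ⟨a.1 i % e i, Nat.mod_lt _ (he i)⟩,
      ⟨Finsupp.equivFunOnFinite.symm (fun i => a.1 i / e i), by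
        have ha : a.1 ∈ auxJ (fun _ => 1) d := by rw [← auxT_eq]; exact a.2
        have ha' : ∑ i, a.1 i * 1 ≤ d := ha
        refine le_trans (Finset.sum_le_sum fun i _ => ?_) ha'
        simpa using Nat.div_mul_le_self _ _⟩)) (by
      intro a b h
      ext i
      simp only [Prod.mk.injEq] at h
      have h1 := congrFun h.1 i
      have h2 := DFunLike.congr_fun (congrArg Subtype.val h.2) i
      simp only [Fin.mk.injEq] at h1
      simp only [Finsupp.equivFunOnFinite_symm_apply_apply] at h2
      rw [← Nat.div_add_mod (a.1 i) (e i), ← Nat.div_add_mod (b.1 i) (e i), h1, h2])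
  simpa [Nat.card_prod] using h

lemma aux_interp {m : ℕ} {K : Type*} [Field K] [DecidableEq K] (S : Finset (Fin m → K)) :
    ∃ g : S → MvPolynomial (Fin m) K, ∀ x y : S, aeval y.1 (g x) = if x = y then (1 : K) else 0 := by
  have h : ∀ x y : S, ∃ l : MvPolynomial (Fin m) K, aeval x.1 l = (1 : K) ∧ (x ≠ y → aeval y.1 l = (0 : K)) := by
    intro x y
    by_cases hxy : x = y
    · exact ⟨1, by simp, fun h => absurd hxy h⟩
    · obtain ⟨k, hk⟩ : ∃ k, x.1 k ≠ y.1 k := by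
        by_contra! h
        exact hxy (Subtype.ext (funext h))
      refine ⟨C (x.1 k - y.1 k)⁻¹ * (X k - C (y.1 k)), ?_, fun _ => ?_⟩
      · simp [inv_mul_cancel₀ (sub_ne_zero.2 hk)]
      · simp
  choose l hl1 hl2 using h
  refine ⟨fun x => ∏ y, l x y, fun x y => ?_⟩
  rw [map_prod]
  split_ifs with hxy
  · subst hxy
    exact Finset.prod_eq_one fun y _ => hl1 x y
  · exact Finset.prod_eq_zero (Finset.mem_univ y) (hl2 x y hxy)

lemma aux_deg {m : ℕ} {K : Type*} [Field K] (f : Fin m → MvPolynomial (Fin m) K) (e : Fin m → ℕ)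
    (hf : ∀ i, (f i).totalDegree ≤ e i) (d : ℕ) (P : MvPolynomial (Fin m) K)
    (hP : P ∈ restrictSupport K (auxJ e d)) : (aeval f P).totalDegree ≤ d := by
  rw [aeval_def, eval₂_eq']
  refine (totalDegree_finsetSum _ _).trans (Finset.sup_le fun j hj => ?_)
  have hj' : ∑ i, j i * e i ≤ d := ((mem_restrictSupport_iff K).1 hP) hj
  refine le_trans (totalDegree_mul _ _) ?_
  rw [show algebraMap K (MvPolynomial (Fin m) K) = C from rfl, totalDegree_C, zero_add]
  refine le_trans (totalDegree_finsetProd _ _) (le_trans (Finset.sum_le_sum fun i _ => ?_) hj')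
  exact (totalDegree_pow _ _).trans (Nat.mul_le_mul_left _ (hf i))

lemma aux_count {m : ℕ} (hm : 0 < m) {K : Type*} [Field K] [IsAlgClosed K] [DecidableEq K]
    (S : Finset (Fin m → K))
    (f : Fin m → MvPolynomial (Fin m) K) (hS : ∀ x ∈ S, ∀ i, aeval x (f i) = 0)
    (hmax : ∀ P : Ideal (MvPolynomial (Fin m) K), P.IsPrime → (∀ i, f i ∈ P) → P.IsMaximal)
    (e : Fin m → ℕ) (he : ∀ i, 0 < e i) (hf : ∀ i, (f i).totalDegree ≤ e i) :
    ∃ D, ∀ d, S.card * Nat.card (auxJ e d) ≤ Nat.card (auxT m (d + D)) := by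
  obtain ⟨g, hg⟩ := aux_interp S
  refine ⟨Finset.univ.sup fun x => (g x).totalDegree, fun d => ?_⟩
  set D := Finset.univ.sup fun x => (g x).totalDegree with hD
  have := auxJ_finite e he d
  let L : (S → restrictSupport K (auxJ e d)) →ₗ[K] restrictTotalDegree (Fin m) K (d + D) :=
    LinearMap.codRestrict _
      (∑ x, (LinearMap.mulRight K (g x)).comp ((aeval f).toLinearMap.comp
        ((restrictSupport K (auxJ e d)).subtype.comp (LinearMap.proj x)))) (by
      intro P
      rw [mem_restrictTotalDegree, LinearMap.sum_apply]
      refine (totalDegree_finsetSum _ _).trans (Finset.sup_le fun x _ => ?_)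
      refine (totalDegree_mul _ _).trans (add_le_add (aux_deg f e hf d _ (P x).2) ?_)
      exact Finset.le_sup (f := fun x => (g x).totalDegree) (Finset.mem_univ x))
  have hL : Function.Injective L := by
    rw [injective_iff_map_eq_zero]
    intro P hP
    have h1 : ∑ x, aeval f (P x).1 * g x = 0 := by
      have := congrArg Subtype.val hP
      simpa [L] using this
    have := aux_indep hm S f hS hmax g hg (fun x => (P x).1) h1
    ext x : 2
    exact this x
  have hfin : Module.Finite K (restrictSupport K (auxJ e d)) :=
    Module.Finite.of_basis (basisRestrictSupport K (auxJ e d))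
  have h := LinearMap.finrank_le_finrank_of_injective hL
  rw [Module.finrank_pi_fintype] at h
  have h1 : Module.finrank K (restrictSupport K (auxJ e d)) = Nat.card (auxJ e d) :=
    Module.finrank_eq_nat_card_basis (basisRestrictSupport K (auxJ e d))
  have h2 : Module.finrank K (restrictTotalDegree (Fin m) K (d + D)) = Nat.card (auxT m (d+D)) :=
    Module.finrank_eq_nat_card_basis (basisRestrictSupport K (auxT m (d+D)))
  simpa [h1, h2] using h

lemma aux_growth (N E m D : ℕ) (T : ℕ → ℕ) (hpos : 0 < T 0) (hT : ∀ d, T d ≤ (d + 1) ^ m)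
    (h : ∀ d, N * T d ≤ E * T (d + D)) : N ≤ E := by
  by_contra! hlt
  have hk : ∀ k, N ^ k ≤ E ^ k * T (k * D) := by
    intro k
    induction k with
    | zero => simpa using Nat.succ_le_of_lt hpos
    | succ k ih =>
      calc N ^ (k+1) = N * N ^ k := by ring
        _ ≤ N * (E ^ k * T (k * D)) := Nat.mul_le_mul_left _ ih
        _ = E ^ k * (N * T (k * D)) := by ring
        _ ≤ E ^ k * (E * T (k * D + D)) := Nat.mul_le_mul_left _ (h _)
        _ = E ^ (k+1) * T ((k+1) * D) := by rw [Nat.succ_mul]; ring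
  have hE : 0 < E := by
    rcases Nat.eq_zero_or_pos E with h0 | h0
    · have := h 0
      rw [h0, zero_mul] at this
      have := Nat.mul_pos (show 0 < N by omega) hpos
      omega
    · exact h0
  have hE' : (0:ℝ) < E := by exact_mod_cast hE
  have hr : (1:ℝ) < (N:ℝ) / E := by
    rw [one_lt_div hE']; exact_mod_cast hlt
  have hlim := tendsto_pow_const_div_const_pow_of_one_lt m hr
  have hev := (hlim.eventually_lt_const (show (0:ℝ) < 1 / ((D:ℝ)+1)^m by positivity)).and
    (Filter.eventually_ge_atTop 1)
  obtain ⟨k, hk1, hk2⟩ := hev.exists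
  have h1 : (N:ℝ) ^ k ≤ E ^ k * ((k:ℝ) * (D+1)) ^ m := by
    have h3 : N ^ k ≤ E ^ k * (k * (D + 1)) ^ m := by
      refine (hk k).trans (Nat.mul_le_mul_left _ ((hT _).trans (Nat.pow_le_pow_left ?_ _)))
      rw [Nat.mul_succ]; omega
    exact_mod_cast h3
  rw [div_lt_div_iff₀ (by positivity) (by positivity), div_pow, ← mul_pow, one_mul,
    lt_div_iff₀ (by positivity)] at hk1
  linarith [mul_comm (((k:ℝ) * (D+1)) ^ m) ((E:ℝ)^k)]

lemma aux_bezout {m : ℕ} (hm : 0 < m) {K : Type*} [Field K] [IsAlgClosed K]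
    (S : Finset (Fin m → K))
    (f : Fin m → MvPolynomial (Fin m) K) (hS : ∀ x ∈ S, ∀ i, aeval x (f i) = 0)
    (hmax : ∀ P : Ideal (MvPolynomial (Fin m) K), P.IsPrime → (∀ i, f i ∈ P) → P.IsMaximal)
    (e : Fin m → ℕ) (he : ∀ i, 0 < e i) (hf : ∀ i, (f i).totalDegree ≤ e i) :
    S.card ≤ ∏ i, e i := by
  classical
  obtain ⟨D, hD⟩ := aux_count hm S f hS hmax e he hf
  refine aux_growth _ _ m D (fun d => Nat.card (auxT m d)) (auxT_card_pos m 0) (auxT_card_le m)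
    fun d => ?_
  calc S.card * Nat.card (auxT m d) ≤ S.card * ((∏ i, e i) * Nat.card (auxJ e d)) :=
        Nat.mul_le_mul_left _ (auxT_le_J e he d)
    _ = (∏ i, e i) * (S.card * Nat.card (auxJ e d)) := by ring
    _ ≤ _ := Nat.mul_le_mul_left _ (hD d)

/-- Chains of primes above `I` have length at most `d`. -/
def auxDim {R : Type*} [CommRing R] (I : Ideal R) (d : ℕ) : Prop :=
  ∀ l : LTSeries (PrimeSpectrum R), I ≤ l.head.asIdeal → l.length ≤ d

lemma auxDim_zero {R : Type*} [CommRing R] (I : Ideal R) (h : auxDim I 0) (P : Ideal R)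
    (hP : P.IsPrime) (hI : I ≤ P) : P.IsMaximal := by
  obtain ⟨M, hM, hle⟩ := Ideal.exists_le_maximal P hP.ne_top
  rcases hle.eq_or_lt with h1 | h1
  · rwa [h1]
  · exfalso
    let a : PrimeSpectrum R := ⟨P, hP⟩
    let b : PrimeSpectrum R := ⟨M, hM.isPrime⟩
    have hab : a < b := h1
    have h3 : ((RelSeries.singleton _ b).cons a hab : LTSeries (PrimeSpectrum R)).length ≤ 0 := h _ hI
    exact absurd h3 (by erw [RelSeries.cons_length]; omega)

lemma auxDim_of_quot {R : Type*} [CommRing R] (I J : Ideal R) (d : ℕ) (hJ : J ≤ I.radical)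
    (h : ringKrullDim (R ⧸ J) = d) : auxDim I d := by
  intro l hl
  rw [ringKrullDim_quotient] at h
  have hJ' : ∀ i, J ≤ (l i).asIdeal := fun i =>
    (hJ.trans (((l.head).2.radical_le_iff).2 hl)).trans (LTSeries.head_le l i)
  let l' : LTSeries (PrimeSpectrum.zeroLocus (J : Set R)) :=
    { length := l.length
      toFun := fun i => ⟨l i, hJ' i⟩
      step := fun i => l.step i }
  have := Order.LTSeries.length_le_krullDim l'
  rw [h] at this
  exact_mod_cast this

/-- The polynomial `∑ a_k (X_k^p - X_k)`. -/
noncomputable def auxH (p : ℕ) {m : ℕ} {K : Type*} [Field K] :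
    (Fin m → K) →ₗ[K] MvPolynomial (Fin m) K where
  toFun a := ∑ k, C (a k) * (X k ^ p - X k)
  map_add' a b := by simp [add_mul, Finset.sum_add_distrib]
  map_smul' c a := by simp [mul_assoc, Finset.smul_sum, smul_eq_C_mul]

lemma auxH_single (p : ℕ) {m : ℕ} {K : Type*} [Field K] (k : Fin m) :
    auxH p (Pi.single k (1:K)) = X k ^ p - X k := by
  simp only [auxH, LinearMap.coe_mk, AddHom.coe_mk]
  rw [Finset.sum_eq_single k]
  · simp
  · intro b _ hb; simp [hb]
  · simp

lemma auxH_deg (p : ℕ) (hp : 1 ≤ p) {m : ℕ} {K : Type*} [Field K] (a : Fin m → K) :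
    (auxH p a).totalDegree ≤ p := by
  simp only [auxH, LinearMap.coe_mk, AddHom.coe_mk]
  refine (totalDegree_finsetSum _ _).trans (Finset.sup_le fun k _ => ?_)
  refine (totalDegree_mul _ _).trans ?_
  rw [totalDegree_C, zero_add]
  refine (totalDegree_sub _ _).trans (max_le ?_ ?_)
  · rw [totalDegree_X_pow]
  · rw [totalDegree_X]; exact hp

lemma aux_max (p : ℕ) [Fact p.Prime] {m : ℕ} {K : Type*} [Field K] [Algebra (ZMod p) K]
    (P : Ideal (MvPolynomial (Fin m) K)) (hP : P.IsPrime)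
    (h : ∀ k, (X k ^ p - X k : MvPolynomial (Fin m) K) ∈ P) : P.IsMaximal := by
  have h1 : ∀ k, ∃ a : K, (X k - C a : MvPolynomial (Fin m) K) ∈ P := by
    intro k
    have hprod : (X k ^ p - X k : MvPolynomial (Fin m) K) =
        ∏ a : ZMod p, (X k - C (algebraMap (ZMod p) K a)) := by
      have hp1 : 1 < p := (Fact.out : p.Prime).one_lt
      have hr : (Polynomial.X ^ p - Polynomial.X : Polynomial (ZMod p)).roots = Finset.univ.val := by
        have := FiniteField.roots_X_pow_card_sub_X (ZMod p)
        rwa [ZMod.card] at this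
      have hd := FiniteField.X_pow_card_sub_X_natDegree_eq (ZMod p) hp1
      have hmon : (Polynomial.X ^ p - Polynomial.X : Polynomial (ZMod p)).Monic := by
        refine Polynomial.monic_X_pow_sub ?_
        rw [Polynomial.degree_X]; exact_mod_cast hp1
      have h3 := Polynomial.prod_multiset_X_sub_C_of_monic_of_roots_card_eq hmon (by
        rw [hr, hd]; simp [ZMod.card])
      rw [hr] at h3
      have h4 := congrArg (Polynomial.aeval (X k : MvPolynomial (Fin m) K)) h3
      change Polynomial.aeval (X k : MvPolynomial (Fin m) K) (∏ a : ZMod p, (Polynomial.X - Polynomial.C a)) = _ at h4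
      simp only [map_prod, map_sub, map_pow, Polynomial.aeval_X, Polynomial.aeval_C] at h4
      rw [← h4]
      refine Finset.prod_congr rfl fun a _ => ?_
      rw [IsScalarTower.algebraMap_apply (ZMod p) K (MvPolynomial (Fin m) K)]
      rfl
    have := h k
    rw [hprod] at this
    obtain ⟨a, -, ha⟩ := (hP.prod_mem_iff).1 this
    exact ⟨_, ha⟩
  choose a ha using h1
  have hle : (vanishingIdeal K {a} : Ideal (MvPolynomial (Fin m) K)) ≤ P := by
    intro q hq
    rw [mem_vanishingIdeal_singleton_iff] at hq
    have h2 : (Ideal.Quotient.mkₐ K P) = ((Algebra.ofId K _).comp (aeval a : MvPolynomial (Fin m) K →ₐ[K] K)) := by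
      ext i
      simp only [AlgHom.comp_apply, aeval_X]
      exact Ideal.Quotient.eq.2 (ha i)
    have h3 := DFunLike.congr_fun h2 q
    rw [AlgHom.comp_apply, hq, map_zero] at h3
    exact Ideal.Quotient.eq_zero_iff_mem.1 h3
  have hm : (vanishingIdeal K {a} : Ideal (MvPolynomial (Fin m) K)).IsMaximal := inferInstance
  rw [← hm.eq_of_le hP.ne_top hle]
  exact hm

lemma aux_step (p : ℕ) [Fact p.Prime] {m : ℕ} {K : Type*} [Field K] [Infinite K] [Algebra (ZMod p) K]
    (I : Ideal (MvPolynomial (Fin m) K)) (d : ℕ) (h : auxDim I (d + 1)) :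
    ∃ a : Fin m → K, auxDim (I ⊔ Ideal.span {auxH p a}) d := by
  have hfin : I.minimalPrimes.Finite := Ideal.finite_minimalPrimes_of_isNoetherianRing _ I
  have ⟨a, ha⟩ : ∃ a : Fin m → K, ∀ Q ∈ I.minimalPrimes, auxH p a ∈ Q → Q.IsMaximal := by
    have := hfin.to_subtype
    by_contra! hcon
    let W : {Q : I.minimalPrimes // ¬ Q.1.IsMaximal} → Subspace K (Fin m → K) := fun Q =>
      (Q.1.1.restrictScalars K).comap (auxH p)
    obtain ⟨Q, hQ⟩ := Subspace.exists_eq_top_of_iUnion_eq_univ (p := W) (by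
      rw [Set.eq_univ_iff_forall]
      intro a
      obtain ⟨Q, hQ, hmem, hmax⟩ := hcon a
      exact Set.mem_iUnion.2 ⟨⟨⟨Q, hQ⟩, hmax⟩, hmem⟩)
    refine Q.2 (aux_max p _ Q.1.2.1.1 fun k => ?_)
    have : Pi.single k (1:K) ∈ W Q := by rw [hQ]; trivial
    rw [← auxH_single]
    exact this
  refine ⟨a, fun l hl => ?_⟩
  have hI : I ≤ l.head.asIdeal := le_sup_left.trans hl
  have hmem : auxH p a ∈ l.head.asIdeal :=
    hl ((le_sup_right : Ideal.span {auxH p a} ≤ _) (Ideal.mem_span_singleton_self _))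
  have := l.head.2
  obtain ⟨Q, hQ, hQle⟩ := Ideal.exists_minimalPrimes_le hI
  rcases hQle.eq_or_lt with heq | hlt
  · have hmax : l.head.asIdeal.IsMaximal := by
      rw [← heq]; exact ha Q hQ (by rw [heq]; exact hmem)
    by_contra! hlen
    have h0 : l.head < l.last := LTSeries.strictMono l |>.lt_iff_lt.2 (by
      rw [Fin.lt_def]; simp; omega)
    have h1 : l.head.asIdeal < l.last.asIdeal := h0
    exact h1.ne (hmax.eq_of_le l.last.2.ne_top h1.le)
  · let b : PrimeSpectrum (MvPolynomial (Fin m) K) := ⟨Q, hQ.1.1⟩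
    have hb : b < l.head := hlt
    have := h (l.cons b hb) (by simpa using hQ.1.2)
    simp at this
    omega

lemma aux_steps (p : ℕ) [Fact p.Prime] {m : ℕ} {K : Type*} [Field K] [Infinite K] [Algebra (ZMod p) K]
    (d : ℕ) : ∀ (I : Ideal (MvPolynomial (Fin m) K)), auxDim I d →
    ∃ a : Fin d → Fin m → K, auxDim (I ⊔ Ideal.span (Set.range fun i => auxH p (a i))) 0 := by
  induction d with
  | zero => intro I h; exact ⟨fun i => i.elim0, by simpa using h⟩
  | succ d ih =>
    intro I h
    obtain ⟨a, ha⟩ := aux_step p I d h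
    obtain ⟨a', ha'⟩ := ih _ ha
    refine ⟨Fin.cons a a', ?_⟩
    convert ha' using 1
    rw [sup_assoc, ← Ideal.span_union]
    congr 2
    ext z
    simp [Fin.exists_fin_succ, eq_comm]

lemma auxH_vanish (p : ℕ) [Fact p.Prime] {m : ℕ} {K : Type*} [Field K] [CharP K p]
    (a : Fin m → K) (z : Fin m → ℤ) : aeval (fun j => (z j : K)) (auxH p a) = 0 := by
  simp only [auxH, LinearMap.coe_mk, AddHom.coe_mk, map_sum, map_mul, map_sub, map_pow, aeval_X]
  refine Finset.sum_eq_zero fun k _ => ?_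
  have h : ((z k : ℤ) : K) ^ p = z k := by
    have h1 : ((z k : ZMod p)) ^ p = z k := ZMod.pow_card _
    have h2 := congrArg (ZMod.castHom (dvd_refl p) K) h1
    rwa [map_pow, map_intCast] at h2
  rw [h, sub_self, mul_zero]



/-- if `q₁,…,q_s ∈ ℤ[X₁,…,X_m]` have degree at most two and vanish at `0`, and
if for a prime `p > 2M` the common zero set `Q^{(p)} ⊆ F̄_p^m` of their reductions mod `p` has
Krull dimension `m − s`, then the number of integer points of `Q = {q_i = 0} ⊆ ℝ^m` in the
open cube `(−M,M)^m` is at most `2^s p^{m−s}`. -/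
theorem stmt12 (m s : ℕ) (hs : 1 ≤ s) (hms : s ≤ m)
    (q : Fin s → MvPolynomial (Fin m) ℤ)
    (hdeg : ∀ i, (q i).totalDegree ≤ 2)
    (h0 : ∀ i, eval (0 : Fin m → ℤ) (q i) = 0)
    (M : ℝ) (hM : 1 ≤ M)
    (p : ℕ) [hp : Fact p.Prime] (hpM : 2 * M < (p : ℝ))
    (hdim : ringKrullDim
        (MvPolynomial (Fin m) (AlgebraicClosure (ZMod p)) ⧸
          MvPolynomial.vanishingIdeal (AlgebraicClosure (ZMod p))
            {x : Fin m → AlgebraicClosure (ZMod p) |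
              ∀ i, aeval x (q i) = 0}) = ((m - s : ℕ) : WithBot ℕ∞)) :
    {x : Fin m → ℝ |
        (∀ i, aeval x (q i) = 0) ∧ (∀ j, ∃ k : ℤ, x j = (k : ℝ)) ∧
          ∀ j, |x j| < M}.Finite ∧
      {x : Fin m → ℝ |
          (∀ i, aeval x (q i) = 0) ∧ (∀ j, ∃ k : ℤ, x j = (k : ℝ)) ∧
            ∀ j, |x j| < M}.ncard ≤ 2 ^ s * p ^ (m - s) := by
  obtain ⟨k, rfl⟩ := Nat.exists_eq_add_of_le hms
  rw [Nat.add_sub_cancel_left] at hdim ⊢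
  set K := AlgebraicClosure (ZMod p) with hK
  have : Infinite K := IsAlgClosed.instInfinite
  have : CharP K p := charP_of_injective_algebraMap (algebraMap (ZMod p) K).injective p
  let qK : Fin s → MvPolynomial (Fin (s + k)) K := fun i => MvPolynomial.map (algebraMap ℤ K) (q i)
  have hqK : ∀ (x : Fin (s + k) → K) i, aeval x (qK i) = aeval x (q i) := fun x i =>
    aeval_map_algebraMap K x (q i)
  let I : Ideal (MvPolynomial (Fin (s + k)) K) := Ideal.span (Set.range qK)
  have hI : auxDim I k := by
    refine auxDim_of_quot I _ k ?_ hdim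
    rw [← vanishingIdeal_zeroLocus_eq_radical (K := K) I]
    refine le_of_eq ?_
    congr 1
    rw [zeroLocus_span]
    ext x
    change (∀ i, aeval x (q i) = 0) ↔ ∀ r ∈ Set.range qK, aeval x r = 0
    rw [Set.forall_mem_range]
    exact forall_congr' fun i => by rw [hqK]
  obtain ⟨a, ha⟩ := aux_steps p k I hI
  let f : Fin (s + k) → MvPolynomial (Fin (s + k)) K := Fin.append qK (fun i => auxH p (a i))
  have hmax : ∀ P : Ideal (MvPolynomial (Fin (s + k)) K), P.IsPrime → (∀ i, f i ∈ P) →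
      P.IsMaximal := by
    intro P hP hf
    refine auxDim_zero _ ha P hP (sup_le ?_ ?_)
    · rw [Ideal.span_le]
      rintro _ ⟨i, rfl⟩
      simpa [f] using hf (Fin.castAdd k i)
    · rw [Ideal.span_le]
      rintro _ ⟨i, rfl⟩
      simpa [f] using hf (Fin.natAdd s i)
  have hp2 : p.Prime := hp.out
  set A := {x : Fin (s + k) → ℝ |
        (∀ i, aeval x (q i) = 0) ∧ (∀ j, ∃ k : ℤ, x j = (k : ℝ)) ∧
          ∀ j, |x j| < M} with hA
  have hround : ∀ x ∈ A, ∀ j, x j = (round (x j) : ℝ) := by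
    intro x hx j
    obtain ⟨z, hz⟩ := hx.2.1 j
    rw [hz, round_intCast]
  let φ : (Fin (s + k) → ℝ) → (Fin (s + k) → K) := fun x j => ((round (x j) : ℤ) : K)
  have hinj : Set.InjOn φ A := by
    intro x hx y hy hxy
    funext j
    have h1 : ((round (x j) : ℤ) : K) = ((round (y j) : ℤ) : K) := congrFun hxy j
    have h2 : ((round (x j) - round (y j) : ℤ) : K) = 0 := by push_cast; rw [h1, sub_self]
    rw [CharP.intCast_eq_zero_iff K p] at h2
    have h3 : |round (x j) - round (y j)| < (p : ℤ) := by
      have h4 : |x j - y j| < p := by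
        have := hx.2.2 j
        have := hy.2.2 j
        have := abs_sub (x j) (y j)
        linarith
      rw [hround x hx j, hround y hy j] at h4
      exact_mod_cast h4
    have h5 := Int.eq_zero_of_abs_lt_dvd h2 h3
    rw [hround x hx j, hround y hy j]
    exact_mod_cast sub_eq_zero.1 h5
  have hfinB : (φ '' A).Finite := by
    refine Set.Finite.subset (Set.finite_range (fun (z : Fin (s + k) → ZMod p) j =>
      algebraMap (ZMod p) K (z j))) ?_
    rintro _ ⟨x, -, rfl⟩
    exact ⟨fun j => ((round (x j) : ℤ) : ZMod p), by funext j; simp [φ]⟩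
  have hfinA : A.Finite := Set.Finite.of_finite_image hfinB hinj
  refine ⟨hfinA, ?_⟩
  rw [← hinj.ncard_image, Set.ncard_eq_toFinset_card _ hfinB]
  have hvan : ∀ x ∈ A, ∀ i, aeval (φ x) (f i) = 0 := by
    intro x hx i
    refine Fin.addCases (fun i => ?_) (fun i => ?_) i
    · simp only [f, Fin.append_left]
      rw [hqK]
      have h1 : x = fun j => algebraMap ℤ ℝ (round (x j)) := funext (hround x hx)
      have h2 := hx.1 i
      rw [h1] at h2
      have h3 : aeval (fun j => round (x j)) (q i) = 0 := by
        have h4 := aeval_algebraMap_apply ℝ (fun j => round (x j)) (q i)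
        have h5 : algebraMap ℤ ℝ (aeval (fun j => round (x j)) (q i)) = 0 := by
          rw [← h4]; exact h2
        exact (Int.cast_eq_zero (α := ℝ)).1 h5
      have h4 := aeval_algebraMap_apply K (fun j => round (x j)) (q i)
      rw [h3, map_zero] at h4
      exact h4
    · simp only [f, Fin.append_right]
      exact auxH_vanish p (a i) _
  have := aux_bezout (by omega) hfinB.toFinset f (by
      intro y hy
      rw [Set.Finite.mem_toFinset] at hy
      obtain ⟨x, hx, rfl⟩ := hy
      exact hvan x hx) hmax (Fin.append (fun _ => 2) (fun _ => p)) (by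
      intro i
      refine Fin.addCases (fun i => ?_) (fun i => ?_) i
      · simp
      · simpa using hp2.pos) (by
      intro i
      refine Fin.addCases (fun i => ?_) (fun i => ?_) i
      · simp only [f, Fin.append_left]
        exact (Finset.sup_mono (support_map_subset _ _)).trans (hdeg i)
      · simp only [f, Fin.append_right]
        exact auxH_deg p hp2.one_le _)
  simpa [Fin.prod_univ_add] using this
end
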